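/- Let x be the horizontal component of the Peano curve, and let p = p'/q' where p' and q' are positive integers not divisible by 3. Then for every continuous g : ℝ → ℝ and every t ∈ [0,1], lim_{n→∞} 3^{-n}p · ∫_ℝ n_t^{z,3^{-n}p}(x) g(z) dz = C_p · ∫_0^t g(x(s)) ds, where C_p = 3^{⌊-log₃ p⌋}·p·(1 - (3/4)·3^{⌊-log₃ p⌋}·p). -/

import Mathlib

open scoped BigOperators Classical
open Filter

noncomputable section

/-- The digit map `k n = 2 - n` on `{0,1,2}` (with truncated natural subtraction). -/
def peanoK : ℕ → ℕ := fun n => 2 - n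

/-- The `m`-th (0-indexed) ternary digit of the horizontal component of the Peano curve
evaluated at the point with ternary digits `d` (0-indexed, i.e. `t_j = d (j-1)`):
the `j`-th digit of `x(t)` is `k^[t_2 + t_4 + ⋯ + t_{2j-2}] (t_{2j-1})`. -/
def peanoXDigit (d : ℕ → Fin 3) (m : ℕ) : ℕ :=
  peanoK^[∑ i ∈ Finset.range m, (d (2 * i + 1) : ℕ)] (d (2 * m) : ℕ)

/-- `x : ℝ → ℝ` is (on `[0,1]`) the horizontal component of the Peano curve:
for every ternary expansion `t = Σ_j d_j 3^{-(j+1)}`, `x t` is given by the digit formula. -/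
def IsPeanoX (x : ℝ → ℝ) : Prop :=
  ∀ d : ℕ → Fin 3,
    x (∑' j : ℕ, (d j : ℝ) / 3 ^ (j + 1)) = ∑' m : ℕ, (peanoXDigit d m : ℝ) / 3 ^ (m + 1)

/-- The grid `cℤ + r = {cq + r : q ∈ ℤ}`. -/
def peanoGrid (c r : ℝ) : Set ℝ := {u : ℝ | ∃ q : ℤ, u = c * q + r}

/-- `lebTime x c r m` is the time `t_{m+1}(c,r)` of the Lebesgue partition `π(c,r)` for `x`
on `[0,1]` (values in `[0,1] ∪ {+∞}`, modelled in `EReal`; `sInf ∅ = ⊤ = +∞`). -/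
def lebTime (x : ℝ → ℝ) (c r : ℝ) : ℕ → EReal
  | 0 => sInf (Real.toEReal '' {t : ℝ | t ∈ Set.Icc (0 : ℝ) 1 ∧ x t ∈ peanoGrid c r})
  | m + 1 =>
    if lebTime x c r m = ⊤ then ⊤
    else
      sInf (Real.toEReal ''
        {t : ℝ | t ∈ Set.Icc ((lebTime x c r m).toReal) 1 ∧ x t ∈ peanoGrid c r ∧
          x t ≠ x ((lebTime x c r m).toReal)})

/-- `k(c,r,t) = min{m ∈ ℕ₊ : t_m(c,r) ≥ t}` (recall `t_m(c,r) = lebTime x c r (m-1)`). -/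
def kIdx (x : ℝ → ℝ) (c r t : ℝ) : ℕ :=
  sInf {m : ℕ | 1 ≤ m ∧ (t : EReal) ≤ lebTime x c r (m - 1)}

/-- `l(c,r,t) = max{m ∈ ℕ₊ : t_m(c,r) ≤ t}`. -/
def lIdx (x : ℝ → ℝ) (c r t : ℝ) : ℕ :=
  sSup {m : ℕ | 1 ≤ m ∧ lebTime x c r (m - 1) ≤ (t : EReal)}

/-- The quadratic variation `[x]_{s,t}^{c,r}` of `x` on `[s,t]` along the Lebesgue partition
`π(c,r)`: the sum over `m = k(c,r,s), …, l(c,r,t) - 1` of `(x(t_{m+1}) - x(t_m))²`. -/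
def qvar (x : ℝ → ℝ) (c r s t : ℝ) : ℝ :=
  ∑ m ∈ Finset.Ico (kIdx x c r s) (lIdx x c r t),
    (x ((lebTime x c r m).toReal) - x ((lebTime x c r (m - 1)).toReal)) ^ 2

/-- `[x]_t^{c,r} := [x]_{0,t}^{c,r}`. -/
def qvar0 (x : ℝ → ℝ) (c r t : ℝ) : ℝ := qvar x c r 0 t

/-- First time in `[a, t]` at which `x` satisfies the predicate `P` (`⊤` if there is none,
or if `a = ⊤`). -/
def hitTime (x : ℝ → ℝ) (t : ℝ) (a : EReal) (P : ℝ → Prop) : EReal :=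
  sInf (Real.toEReal '' {u : ℝ | a ≤ (u : EReal) ∧ u ≤ t ∧ P (x u)})

/-- The pair `(σ_n, τ_n)` of crossing times of the interval `[z - c/2, z + c/2]` by `x`
on the time interval `[0, t]`: `σ_0 = 0`, `τ_n = inf{u ∈ [σ_n, t] : x u ≥ z + c/2}`,
`σ_{n+1} = inf{u ∈ [τ_n, t] : x u < z - c/2}`. -/
def crossTimes (x : ℝ → ℝ) (z c t : ℝ) : ℕ → EReal × EReal
  | 0 => ((0 : EReal), hitTime x t (0 : EReal) (fun y => z + c / 2 ≤ y))
  | n + 1 =>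
    let σ : EReal := hitTime x t (crossTimes x z c t n).2 (fun y => y < z - c / 2)
    (σ, hitTime x t σ (fun y => z + c / 2 ≤ y))

/-- The number of downcrossings `d_t^{z,c}(x) = max{n : σ_n ≤ t}`. -/
def downCross (x : ℝ → ℝ) (z c t : ℝ) : ℕ :=
  sSup {n : ℕ | (crossTimes x z c t n).1 ≤ (t : EReal)}

/-- The number of upcrossings `u_t^{z,c}(x) = d_t^{-z,c}(-x)`. -/
def upCross (x : ℝ → ℝ) (z c t : ℝ) : ℕ :=
  downCross (fun u => -x u) (-z) c t

/-- The number of crossings by `x` of the interval `[z - c/2, z + c/2]` on `[0,t]`. -/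
def crossCount (x : ℝ → ℝ) (z c t : ℝ) : ℕ :=
  upCross x z c t + downCross x z c t

section PeanoCurve

theorem peanoK_iterate (v n : ℕ) (hn : n ≤ 2) : peanoK^[v] n = if Odd v then 2 - n else n := by
  induction v with
  | zero => simp
  | succ v ih =>
    rw [Function.iterate_succ_apply', ih]
    by_cases h : Odd v
    · simp only [h, Nat.odd_add_one, peanoK, if_true, not_true_eq_false, if_false]; omega
    · simp only [h, Nat.odd_add_one, peanoK, if_true, not_false_eq_true, if_false]

theorem peanoXDigit_lt (d : ℕ → Fin 3) (m : ℕ) : peanoXDigit d m < 3 := by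
  have h : ((d (2 * m) : Fin 3) : ℕ) ≤ 2 := by omega
  rw [peanoXDigit, peanoK_iterate _ _ h]
  split_ifs <;> omega

/-- The ternary digits of the value of the Peano component, as a digit sequence. -/
def peanoXDigits (d : ℕ → Fin 3) (m : ℕ) : Fin 3 := ⟨peanoXDigit d m, peanoXDigit_lt d m⟩

theorem Real.ofDigits_three (d : ℕ → Fin 3) :
    Real.ofDigits d = ∑' j : ℕ, (d j : ℝ) / 3 ^ (j + 1) := by
  simp [Real.ofDigits, Real.ofDigitsTerm, div_eq_mul_inv]

theorem IsPeanoX.apply_ofDigits {x : ℝ → ℝ} (hx : IsPeanoX x) (d : ℕ → Fin 3) :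
    x (Real.ofDigits d) = Real.ofDigits (peanoXDigits d) := by
  rw [Real.ofDigits_three, Real.ofDigits_three, hx d]
  rfl

theorem exists_ofDigits_eq {u : ℝ} (hu : u ∈ Set.Icc (0 : ℝ) 1) :
    ∃ d : ℕ → Fin 3, Real.ofDigits d = u := by
  obtain ⟨d, -, hd⟩ := Real.ofDigits_SurjOn (b := 3) (by norm_num) hu
  exact ⟨d, hd⟩

theorem Real.ofDigits_succ (d : ℕ → Fin 3) :
    Real.ofDigits d = (d 0 : ℝ) / 3 + Real.ofDigits (fun n => d (n + 1)) / 3 := by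
  have h := Real.ofDigits_eq_sum_add_ofDigits d 1
  simp only [Finset.sum_range_one, Real.ofDigitsTerm] at h
  rw [h]
  norm_num
  ring

theorem Real.ofDigits_flip (d e : ℕ → Fin 3) (h : ∀ n, (e n : ℕ) = 2 - (d n : ℕ)) :
    Real.ofDigits e = 1 - Real.ofDigits d := by
  have h1 : Real.ofDigits (fun _ => Fin.last 2 : ℕ → Fin 3) = 1 :=
    Real.ofDigits_const_last_eq_one 2
  rw [eq_sub_iff_add_eq, ← h1, Real.ofDigits, Real.ofDigits, Real.ofDigits,
    ← Summable.tsum_add Real.summable_ofDigitsTerm Real.summable_ofDigitsTerm]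
  congr 1
  ext n
  have h2 : ((e n : ℕ) : ℝ) + (d n : ℕ) = 2 := by
    have : (e n : ℕ) + (d n : ℕ) = 2 := by have := h n; omega
    exact_mod_cast this
  simp only [Real.ofDigitsTerm, ← add_mul, h2]
  simp

variable {x : ℝ → ℝ}

theorem IsPeanoX.mem_Icc (hx : IsPeanoX x) {u : ℝ} (hu : u ∈ Set.Icc (0 : ℝ) 1) :
    x u ∈ Set.Icc (0 : ℝ) 1 := by
  obtain ⟨d, rfl⟩ := exists_ofDigits_eq hu
  rw [hx.apply_ofDigits]
  exact ⟨Real.ofDigits_nonneg _, Real.ofDigits_le_one _⟩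

theorem IsPeanoX.apply_subdivision (hx : IsPeanoX x) (a b : Fin 3) {u : ℝ}
    (hu : u ∈ Set.Icc (0 : ℝ) 1) :
    x ((a : ℝ) / 3 + (b : ℝ) / 9 + u / 9) =
      (a : ℝ) / 3 + (if Odd (b : ℕ) then 1 - x u else x u) / 3 := by
  obtain ⟨d, rfl⟩ := exists_ofDigits_eq hu
  let e : ℕ → Fin 3 := fun n => match n with
    | 0 => a
    | 1 => b
    | n + 2 => d n
  have he : Real.ofDigits e = (a : ℝ) / 3 + (b : ℝ) / 9 + Real.ofDigits d / 9 := by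
    rw [Real.ofDigits_succ, Real.ofDigits_succ (fun n => e (n + 1))]
    change (a : ℝ) / 3 + ((b : ℝ) / 3 + Real.ofDigits d / 3) / 3 = _
    ring
  have hdig : ∀ n, (peanoXDigits e (n + 1) : ℕ) = peanoK^[(b : ℕ)] (peanoXDigit d n) := by
    intro n
    change peanoXDigit e (n + 1) = _
    rw [peanoXDigit, peanoXDigit, Finset.sum_range_succ', add_comm, Function.iterate_add_apply]
    rfl
  rw [← he, hx.apply_ofDigits, hx.apply_ofDigits, Real.ofDigits_succ (peanoXDigits e)]
  congr 2
  split_ifs with hb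
  · apply Real.ofDigits_flip
    intro n
    rw [hdig, peanoK_iterate _ _ (Nat.le_of_lt_succ (peanoXDigit_lt d n)), if_pos hb]
    rfl
  · congr 1
    ext n
    rw [hdig, peanoK_iterate _ _ (Nat.le_of_lt_succ (peanoXDigit_lt d n)), if_neg hb]
    rfl

theorem IsPeanoX.apply_zero (hx : IsPeanoX x) : x 0 = 0 := by
  have h := hx.apply_subdivision 0 0 (u := 0) (by simp)
  norm_num at h
  linarith

theorem IsPeanoX.apply_one (hx : IsPeanoX x) : x 1 = 1 := by
  have h := hx.apply_subdivision 2 2 (u := 1) (by simp)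
  rw [if_neg (by decide)] at h
  norm_num at h
  linarith

/-- The Peano component cannot drop by more than a third. -/
theorem IsPeanoX.sub_le (hx : IsPeanoX x) {u v : ℝ} (hu : u ∈ Set.Icc (0 : ℝ) 1)
    (hv : v ∈ Set.Icc (0 : ℝ) 1) (huv : u ≤ v) : x u - x v ≤ 1 / 3 := by
  have key : ∀ w ∈ Set.Icc (0 : ℝ) 1, ∃ a : ℕ, (a : ℝ) / 3 ≤ w ∧ w ≤ (a + 1) / 3 ∧
      (a : ℝ) / 3 ≤ x w ∧ x w ≤ (a + 1) / 3 := by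
    intro w hw
    obtain ⟨d, rfl⟩ := exists_ofDigits_eq hw
    refine ⟨d 0, ?_⟩
    rw [hx.apply_ofDigits, Real.ofDigits_succ d, Real.ofDigits_succ (peanoXDigits d)]
    have h0 : ((peanoXDigits d 0 : ℕ) : ℝ) = (d 0 : ℕ) := rfl
    have h1 := Real.ofDigits_nonneg (fun n => d (n + 1))
    have h2 := Real.ofDigits_le_one (fun n => d (n + 1))
    have h3 := Real.ofDigits_nonneg (fun n => peanoXDigits d (n + 1))
    have h4 := Real.ofDigits_le_one (fun n => peanoXDigits d (n + 1))
    rw [h0]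
    refine ⟨?_, ?_, ?_, ?_⟩ <;> linarith
  obtain ⟨a, ha1, ha2, ha3, ha4⟩ := key u hu
  obtain ⟨b, hb1, hb2, hb3, hb4⟩ := key v hv
  rcases le_or_gt a b with hab | hab
  · have : (a : ℝ) ≤ b := by exact_mod_cast hab
    linarith
  · have : (b : ℝ) + 1 ≤ a := by exact_mod_cast hab
    have huv' : u = v := by linarith
    rw [huv']
    norm_num

/-- The sign of the `k`-th unit step of the integer path that the Peano component follows at every
sufficiently fine level. -/
def stepSign : ℕ → ℤ
  | 0 => 1
  | k + 1 => stepSign ((k + 1) / 9) * (if Odd ((k + 1) % 9 % 3) then -1 else 1)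
  decreasing_by omega

/-- The height of the integer path before its `k`-th step. -/
def height (k : ℕ) : ℤ := ∑ i ∈ Finset.range k, stepSign i

theorem stepSign_eq (a b : Fin 3) (k : ℕ) :
    stepSign (9 * k + 3 * a + b) = stepSign k * (if Odd (b : ℕ) then -1 else 1) := by
  rcases h : 9 * k + 3 * (a : ℕ) + (b : ℕ) with _ | n
  · have hk : k = 0 := by omega
    have hb : (b : ℕ) = 0 := by omega
    simp [hk, hb, stepSign]
  · rw [stepSign, ← h]
    have h1 : (9 * k + 3 * (a : ℕ) + (b : ℕ)) / 9 = k := by omega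
    have h2 : (9 * k + 3 * (a : ℕ) + (b : ℕ)) % 9 % 3 = b := by omega
    rw [h1, h2]

theorem stepSign_eq_or (k : ℕ) : stepSign k = 1 ∨ stepSign k = -1 := by
  induction k using Nat.strong_induction_on with
  | _ k ih =>
    rcases k with _ | k
    · simp [stepSign]
    · rw [stepSign]
      rcases ih ((k + 1) / 9) (by omega) with h | h <;> rw [h] <;> split_ifs <;> simp

theorem height_succ (k : ℕ) : height (k + 1) = height k + stepSign k :=
  Finset.sum_range_succ _ _

theorem stepSign_nine_mul (k : ℕ) (i : ℕ) (hi : i < 9) :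
    stepSign (9 * k + i) = stepSign k * (if Odd (i % 3) then -1 else 1) := by
  have h := stepSign_eq ⟨i / 3, by omega⟩ ⟨i % 3, by omega⟩ k
  simp only at h
  rw [← h]
  congr 1
  omega

theorem height_nine_mul (k : ℕ) : height (9 * k) = 3 * height k := by
  induction k with
  | zero => simp [height]
  | succ k ih =>
    have h0 := stepSign_nine_mul k 0 (by norm_num)
    have h1 := stepSign_nine_mul k 1 (by norm_num)
    have h2 := stepSign_nine_mul k 2 (by norm_num)
    have h3 := stepSign_nine_mul k 3 (by norm_num)
    have h4 := stepSign_nine_mul k 4 (by norm_num)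
    have h5 := stepSign_nine_mul k 5 (by norm_num)
    have h6 := stepSign_nine_mul k 6 (by norm_num)
    have h7 := stepSign_nine_mul k 7 (by norm_num)
    have h8 := stepSign_nine_mul k 8 (by norm_num)
    norm_num [Nat.odd_iff] at h0 h1 h2 h3 h4 h5 h6 h7 h8
    rw [show 9 * (k + 1) = 9 * k + 8 + 1 by ring]
    iterate 9 rw [height_succ]
    rw [height_succ k, Nat.add_zero, ih, h0, h1, h2, h3, h4, h5, h6, h7, h8]
    ring

theorem height_subdivision (a b : Fin 3) (k : ℕ) :
    height (9 * k + 3 * a + b) =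
      3 * height k + stepSign k * (a + if Odd (b : ℕ) then 1 else 0) := by
  have h : height (9 * k + (3 * a + b : ℕ)) =
      height (9 * k) + ∑ i ∈ Finset.range (3 * a + b), stepSign (9 * k + i) :=
    Finset.sum_range_add _ _ _
  rw [add_assoc, h, height_nine_mul, Finset.sum_congr rfl (g := fun i =>
    stepSign k * (if Odd (i % 3) then -1 else 1)) (fun i hi =>
      stepSign_nine_mul k i (by have := Finset.mem_range.1 hi; omega)), ← Finset.mul_sum]
  congr 2
  fin_cases a <;> fin_cases b <;> decide

/-- At level `m`, the Peano component follows the integer path, up to rescaled copies of itself. -/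
theorem IsPeanoX.apply_level (hx : IsPeanoX x) (m k : ℕ) (hk : k < 9 ^ m) {u : ℝ}
    (hu : u ∈ Set.Icc (0 : ℝ) 1) :
    x ((k + u) / 9 ^ m) =
      (height k + if stepSign k = 1 then x u else - x u) / 3 ^ m := by
  induction m generalizing k u with
  | zero =>
    have hk0 : k = 0 := by simpa using hk
    simp [hk0, height, stepSign]
  | succ m ih =>
    obtain ⟨j, a, b, rfl⟩ : ∃ (j : ℕ) (a b : Fin 3), k = 9 * j + 3 * a + b :=
      ⟨k / 9, ⟨k % 9 / 3, by omega⟩, ⟨k % 9 % 3, by omega⟩, by simp only; omega⟩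
    have hj : j < 9 ^ m := by rw [pow_succ] at hk; omega
    have ha : ((a : ℕ) : ℝ) ≤ 2 := by exact_mod_cast (by omega : (a : ℕ) ≤ 2)
    have hb : ((b : ℕ) : ℝ) ≤ 2 := by exact_mod_cast (by omega : (b : ℕ) ≤ 2)
    have hw : (a : ℝ) / 3 + (b : ℝ) / 9 + u / 9 ∈ Set.Icc (0 : ℝ) 1 :=
      ⟨by have := hu.1; positivity, by linarith [hu.2]⟩
    have h := ih j hj hw
    rw [hx.apply_subdivision a b hu] at h
    have e : (((9 * j + 3 * a + b : ℕ) : ℝ) + u) / 9 ^ (m + 1) =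
        (j + ((a : ℝ) / 3 + (b : ℝ) / 9 + u / 9)) / 9 ^ m := by
      push_cast
      field_simp
      ring
    rw [e, h, height_subdivision, stepSign_eq]
    rcases stepSign_eq_or j with hs | hs <;> by_cases hb : Odd (b : ℕ) <;> simp only [hs, hb] <;>
      norm_num <;> field_simp <;> ring

/-- On the time scale `1 / T` and the space scale `δ`, the function `f` follows the integer
nearest-neighbour path `y` on `[0, 1]`: it stays within each edge while that edge is traversed and
never moves back by `c` or more in the meantime. -/
structure FollowsPath (f : ℝ → ℝ) (T : ℕ) (δ c : ℝ) (y : ℕ → ℤ) : Prop where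
  succ_eq_or : ∀ k, y (k + 1) = y k + 1 ∨ y (k + 1) = y k - 1
  apply_node : ∀ k ≤ T, f (k / T) = δ * y k
  mem_edge : ∀ k < T, ∀ u, (k : ℝ) ≤ T * u → T * u ≤ k + 1 →
    δ * (min (y k) (y (k + 1)) : ℤ) ≤ f u ∧ f u ≤ δ * (max (y k) (y (k + 1)) : ℤ)
  backward_up : ∀ k < T, y (k + 1) = y k + 1 → ∀ u v, u ≤ v → (k : ℝ) ≤ T * u →
    T * v ≤ k + 1 → f u - f v < c
  backward_down : ∀ k < T, y (k + 1) = y k - 1 → ∀ u v, u ≤ v → (k : ℝ) ≤ T * u →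
    T * v ≤ k + 1 → f v - f u < c

theorem IsPeanoX.apply_node (hx : IsPeanoX x) (m k : ℕ) (hk : k ≤ 9 ^ m) :
    x (k / 9 ^ m) = height k / 3 ^ m := by
  rcases hk.lt_or_eq with h | h
  · have := hx.apply_level m k h (u := 0) (by simp)
    rw [hx.apply_zero] at this
    simpa using this
  · obtain ⟨j, rfl⟩ : ∃ j, k = j + 1 := ⟨k - 1, by
      have : 0 < 9 ^ m := by positivity
      omega⟩
    have := hx.apply_level m j (by omega) (u := 1) (by simp)
    rw [hx.apply_one] at this
    push_cast
    rw [this, height_succ]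
    rcases stepSign_eq_or j with h | h <;> simp [h]

theorem IsPeanoX.apply_of_mem_step (hx : IsPeanoX x) (m k : ℕ) (hk : k < 9 ^ m) {u : ℝ}
    (h1 : (k : ℝ) ≤ 9 ^ m * u) (h2 : 9 ^ m * u ≤ k + 1) :
    9 ^ m * u - k ∈ Set.Icc (0 : ℝ) 1 ∧ x u =
      (height k + if stepSign k = 1 then x (9 ^ m * u - k) else - x (9 ^ m * u - k)) / 3 ^ m := by
  have hu : 9 ^ m * u - k ∈ Set.Icc (0 : ℝ) 1 := ⟨by linarith, by linarith⟩
  refine ⟨hu, ?_⟩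
  rw [← hx.apply_level m k hk hu]
  congr 1
  field_simp
  ring

theorem IsPeanoX.followsPath (hx : IsPeanoX x) (m : ℕ) {c : ℝ} (hc : 1 / 3 / 3 ^ m < c) :
    FollowsPath x (9 ^ m) (1 / 3 ^ m) c height where
  succ_eq_or k := by
    rw [height_succ]
    rcases stepSign_eq_or k with h | h <;> rw [h] <;> omega
  apply_node k hk := by
    have := hx.apply_node m k hk
    push_cast
    rw [this]
    ring
  mem_edge k hk u h1 h2 := by
    push_cast at h1 h2
    obtain ⟨hu, he⟩ := hx.apply_of_mem_step m k hk h1 h2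
    have hxu := hx.mem_Icc hu
    have h3 : (0 : ℝ) ≤ 1 / 3 ^ m := by positivity
    rw [he, height_succ, div_eq_mul_one_div (_ + _), mul_comm (_ + _)]
    rcases stepSign_eq_or k with h | h
    · rw [h, min_eq_left (by omega), max_eq_right (by omega), if_pos rfl]
      push_cast
      constructor <;> refine mul_le_mul_of_nonneg_left ?_ h3 <;> linarith [hxu.1, hxu.2]
    · rw [h, min_eq_right (by omega), max_eq_left (by omega), if_neg (by norm_num)]
      push_cast
      constructor <;> refine mul_le_mul_of_nonneg_left ?_ h3 <;> linarith [hxu.1, hxu.2]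
  backward_up k hk h u v huv h1 h2 := by
    push_cast at h1 h2
    rw [height_succ] at h
    obtain ⟨hu, he⟩ := hx.apply_of_mem_step m k hk h1 (h2.trans' (by gcongr))
    obtain ⟨hv, he'⟩ := hx.apply_of_mem_step m k hk (h1.trans (by gcongr)) h2
    rw [he, he', ← sub_div, if_pos (by omega), if_pos (by omega)]
    refine lt_of_le_of_lt ?_ hc
    gcongr
    have := hx.sub_le hu hv (by gcongr)
    linarith
  backward_down k hk h u v huv h1 h2 := by
    push_cast at h1 h2
    rw [height_succ] at h
    obtain ⟨hu, he⟩ := hx.apply_of_mem_step m k hk h1 (h2.trans' (by gcongr))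
    obtain ⟨hv, he'⟩ := hx.apply_of_mem_step m k hk (h1.trans (by gcongr)) h2
    rw [he, he', ← sub_div, if_neg (by omega), if_neg (by omega)]
    refine lt_of_le_of_lt ?_ hc
    gcongr
    have := hx.sub_le hu hv (by gcongr)
    linarith

theorem FollowsPath.neg {f : ℝ → ℝ} {T : ℕ} {δ c : ℝ} {y : ℕ → ℤ} (h : FollowsPath f T δ c y) :
    FollowsPath (fun u => - f u) T δ c (fun k => - y k) where
  succ_eq_or k := by have := h.succ_eq_or k; omega
  apply_node k hk := by rw [h.apply_node k hk]; push_cast; ring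
  mem_edge k hk u h1 h2 := by
    obtain ⟨h3, h4⟩ := h.mem_edge k hk u h1 h2
    rw [min_neg_neg, max_neg_neg]
    push_cast at *
    constructor <;> linarith
  backward_up k hk hy u v huv h1 h2 := by
    have := h.backward_down k hk (by omega) u v huv h1 h2
    linarith
  backward_down k hk hy u v huv h1 h2 := by
    have := h.backward_up k hk (by omega) u v huv h1 h2
    linarith

/-- The index of a step, among the first `T`, during which the time `u` occurs. -/
def stepIndex (T : ℕ) (u : ℝ) : ℕ := min ⌊(T : ℝ) * u⌋₊ (T - 1)

theorem stepIndex_mono (T : ℕ) {u v : ℝ} (h : u ≤ v) : stepIndex T u ≤ stepIndex T v := by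
  unfold stepIndex
  gcongr

theorem stepIndex_spec {T : ℕ} (hT : 0 < T) {u : ℝ} (hu : u ∈ Set.Icc (0 : ℝ) 1) :
    stepIndex T u < T ∧ (stepIndex T u : ℝ) ≤ T * u ∧ T * u ≤ stepIndex T u + 1 := by
  have h0 : (0 : ℝ) ≤ T * u := by have := hu.1; positivity
  have h1 : (stepIndex T u : ℝ) ≤ (⌊(T : ℝ) * u⌋₊ : ℕ) := by
    exact_mod_cast min_le_left _ _
  refine ⟨by unfold stepIndex; omega, h1.trans (Nat.floor_le h0), ?_⟩
  rcases le_total ⌊(T : ℝ) * u⌋₊ (T - 1) with h | h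
  · rw [stepIndex, min_eq_left h]
    exact (Nat.lt_floor_add_one _).le
  · rw [stepIndex, min_eq_right h, Nat.cast_sub hT]
    have : (T : ℝ) * u ≤ T * 1 := by gcongr; exact hu.2
    push_cast
    linarith

/-- Times less than `1 / T` apart lie in the same step or in adjacent steps. -/
theorem stepIndex_le_add_one {T : ℕ} (hT : 0 < T) {u v : ℝ} (hu : u ∈ Set.Icc (0 : ℝ) 1)
    (hv : v ∈ Set.Icc (0 : ℝ) 1) (h : T * (v - u) < 1) : stepIndex T v ≤ stepIndex T u + 1 := by
  have h1 := (stepIndex_spec hT hu).2.2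
  have h2 := (stepIndex_spec hT hv).2.1
  have : (stepIndex T v : ℝ) < stepIndex T u + 2 := by linarith
  have : stepIndex T v < stepIndex T u + 2 := by exact_mod_cast this
  omega

/-- The function `f` completes at least `n` downcrossings from `[hi, ∞)` to `(-∞, lo)` in the time
interval `[0, s]`. -/
def HasDowncrossings (f : ℝ → ℝ) (lo hi : ℝ) : ℕ → ℝ → Prop
  | 0, s => 0 ≤ s
  | n + 1, s => ∃ a b, HasDowncrossings f lo hi n a ∧ a ≤ b ∧ b ≤ s ∧ hi ≤ f a ∧ f b < lo

section Chains

variable {f : ℝ → ℝ} {lo hi : ℝ}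

theorem HasDowncrossings.nonneg {n : ℕ} {s : ℝ} (h : HasDowncrossings f lo hi n s) : 0 ≤ s := by
  induction n generalizing s with
  | zero => exact h
  | succ n ih =>
    obtain ⟨a, b, h1, h2, h3, -⟩ := h
    linarith [ih h1]

theorem HasDowncrossings.mono {n : ℕ} {s s' : ℝ} (h : HasDowncrossings f lo hi n s)
    (hs : s ≤ s') : HasDowncrossings f lo hi n s' := by
  cases n with
  | zero => exact le_trans h hs
  | succ n =>
    obtain ⟨a, b, h1, h2, h3, h4⟩ := h
    exact ⟨a, b, h1, h2, h3.trans hs, h4⟩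

theorem HasDowncrossings.of_succ {n : ℕ} {s : ℝ} (h : HasDowncrossings f lo hi (n + 1) s) :
    HasDowncrossings f lo hi n s := by
  obtain ⟨a, b, h1, h2, h3, -⟩ := h
  exact h1.mono (h2.trans h3)

theorem HasDowncrossings.of_le {n k : ℕ} {s : ℝ} (h : HasDowncrossings f lo hi n s)
    (hk : k ≤ n) : HasDowncrossings f lo hi k s := by
  induction n, hk using Nat.le_induction with
  | base => exact h
  | succ n hn ih => exact ih h.of_succ

end Chains

section Counting

theorem exists_down_step {y : ℕ → ℤ} (hy : ∀ k, y (k + 1) = y k + 1 ∨ y (k + 1) = y k - 1)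
    (j : ℤ) (p q : ℕ) (hpq : p ≤ q) (hp : j + 1 ≤ y p) (hq : y q ≤ j) :
    ∃ k, p ≤ k ∧ k + 1 ≤ q ∧ y k = j + 1 ∧ y (k + 1) = j := by
  induction q, hpq using Nat.le_induction with
  | base => omega
  | succ q hpq ih =>
    rcases le_or_gt (y q) j with h | h
    · obtain ⟨k, h1, h2, h3⟩ := ih h
      exact ⟨k, h1, by omega, h3⟩
    · exact ⟨q, hpq, le_rfl, by have := hy q; omega, by have := hy q; omega⟩

theorem exists_double_down_step {y : ℕ → ℤ}
    (hy : ∀ k, y (k + 1) = y k + 1 ∨ y (k + 1) = y k - 1)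
    (j : ℤ) (p q : ℕ) (hpq : p ≤ q) (hp : j + 2 ≤ y p) (hq : y q ≤ j) :
    ∃ k, p ≤ k ∧ k + 2 ≤ q ∧ y k = j + 2 ∧ y (k + 1) = j + 1 ∧ y (k + 2) = j := by
  induction q using Nat.strong_induction_on with
  | _ q ih =>
    obtain ⟨k, h1, h2, h3, h4⟩ := exists_down_step hy j p q hpq (by omega) hq
    obtain ⟨i, rfl⟩ : ∃ i, k = i + 1 := ⟨k - 1, by
      have : k ≠ 0 := by
        rintro rfl
        obtain rfl : p = 0 := by omega
        omega
      omega⟩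
    have hpi : p ≤ i := by
      by_contra h
      obtain rfl : p = i + 1 := by omega
      omega
    rcases hy i with h | h
    · obtain ⟨k, h5, h6, h7⟩ := ih i (by omega) hpi (by omega)
      exact ⟨k, h5, by omega, h7⟩
    · exact ⟨i, hpi, by omega, by omega, h3, h4⟩

open Finset in
theorem card_filter_range_lt {P : ℕ → Prop} [DecidablePred P] {M N k : ℕ} (hM : M ≤ k)
    (hN : k < N) (hk : P k) :
    #{i ∈ range M | P i} + 1 ≤ #{i ∈ range N | P i} := by
  rw [← card_insert_of_notMem (a := k) (s := {i ∈ range M | P i}) (by simp; omega)]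
  apply card_le_card
  intro i hi
  simp only [mem_insert, mem_filter, mem_range] at hi ⊢
  rcases hi with rfl | ⟨hi, hi'⟩
  · exact ⟨hN, hk⟩
  · exact ⟨by omega, hi'⟩

open Finset in
theorem card_filter_range_mono {P : ℕ → Prop} [DecidablePred P] {M N : ℕ} (h : M ≤ N) :
    #{i ∈ range M | P i} ≤ #{i ∈ range N | P i} :=
  card_le_card (filter_subset_filter _ (range_mono h))

open Finset in
theorem card_filter_range_succ_le {P : ℕ → Prop} [DecidablePred P] {N : ℕ} :
    #{i ∈ range (N + 1) | P i} ≤ #{i ∈ range N | P i} + 1 := by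
  rw [range_add_one, filter_insert]
  split_ifs
  · exact card_insert_le _ _
  · omega

variable {f : ℝ → ℝ} {T : ℕ} {δ c lo hi : ℝ} {y : ℕ → ℤ}

open Finset

theorem FollowsPath.exists_down_step (h : FollowsPath f T δ c y) (hT : 0 < T) (hδ : 0 < δ)
    (hc : c ≤ hi - lo) {j : ℤ} (hj : δ * j < hi) (hj' : lo ≤ δ * (j + 1)) {a b : ℝ}
    (ha : a ∈ Set.Icc (0 : ℝ) 1) (hb : b ∈ Set.Icc (0 : ℝ) 1) (hab : a ≤ b) (hfa : hi ≤ f a)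
    (hfb : f b < lo) :
    ∃ k, stepIndex T a ≤ k ∧ k ≤ stepIndex T b ∧ y k = j + 1 ∧ y (k + 1) = j := by
  obtain ⟨a1, a2, a3⟩ := stepIndex_spec hT ha
  obtain ⟨b1, b2, b3⟩ := stepIndex_spec hT hb
  have hmono := stepIndex_mono T hab
  have hA : j < max (y (stepIndex T a)) (y (stepIndex T a + 1)) := by
    have := lt_of_lt_of_le (hj.trans_le hfa) (h.mem_edge _ a1 a a2 a3).2
    exact_mod_cast lt_of_mul_lt_mul_left this hδ.le
  have hB : min (y (stepIndex T b)) (y (stepIndex T b + 1)) < j + 1 := by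
    have := lt_of_le_of_lt (h.mem_edge _ b1 b b2 b3).1 (hfb.trans_le hj')
    exact_mod_cast lt_of_mul_lt_mul_left this hδ.le
  rcases hmono.lt_or_eq with hlt | heq
  · obtain ⟨p, hp, hp', hyp⟩ : ∃ p, stepIndex T a ≤ p ∧ p ≤ stepIndex T a + 1 ∧ j + 1 ≤ y p := by
      rcases lt_max_iff.1 hA with hA | hA
      exacts [⟨_, le_rfl, by omega, hA⟩, ⟨_, by omega, le_rfl, hA⟩]
    obtain ⟨q, hq, hq', hyq⟩ : ∃ q, stepIndex T b ≤ q ∧ q ≤ stepIndex T b + 1 ∧ y q ≤ j := by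
      rcases min_lt_iff.1 hB with hB | hB
      exacts [⟨_, le_rfl, by omega, by omega⟩, ⟨_, by omega, le_rfl, by omega⟩]
    obtain ⟨k, h1, h2, h3⟩ := _root_.exists_down_step h.succ_eq_or j p q (by omega) hyp hyq
    exact ⟨k, by omega, by omega, h3⟩
  · rw [heq] at hA a2
    rcases h.succ_eq_or (stepIndex T b) with hs | hs
    · have := h.backward_up _ b1 hs a b hab a2 b3
      linarith
    · exact ⟨stepIndex T b, by omega, le_rfl, by omega, by omega⟩

theorem FollowsPath.card_le_of_hasDowncrossings (h : FollowsPath f T δ c y) (hT : 0 < T)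
    (hδ : 0 < δ) (hc : c ≤ hi - lo) {j : ℤ} (hj : δ * j < hi) (hj' : lo ≤ δ * (j + 1))
    {n : ℕ} {s : ℝ} (hs : s ≤ 1) (hn : HasDowncrossings f lo hi n s) :
    n ≤ #{k ∈ range (stepIndex T s + 1) | y k = j + 1 ∧ y (k + 1) = j} := by
  suffices n = 0 ∨ ∃ b ∈ Set.Icc 0 s, f b < lo ∧
      n ≤ #{k ∈ range (stepIndex T b + 1) | y k = j + 1 ∧ y (k + 1) = j} by
    rcases this with rfl | ⟨b, hb, -, hn⟩
    · exact Nat.zero_le _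
    · exact hn.trans (card_filter_range_mono (by have := stepIndex_mono T hb.2; omega))
  induction n generalizing s with
  | zero => exact Or.inl rfl
  | succ n ih =>
    obtain ⟨a, b, hna, hab, hbs, hfa, hfb⟩ := hn
    have ha0 := hna.nonneg
    have ha : a ∈ Set.Icc (0 : ℝ) 1 := ⟨ha0, by linarith⟩
    have hb : b ∈ Set.Icc (0 : ℝ) 1 := ⟨by linarith, by linarith⟩
    obtain ⟨k, h1, h2, h3, h4⟩ := h.exists_down_step hT hδ hc hj hj' ha hb hab hfa hfb
    refine Or.inr ⟨b, ⟨hb.1, hbs⟩, hfb, ?_⟩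
    rcases ih ha.2 hna with rfl | ⟨b', hb', hfb', hn'⟩
    · refine le_trans ?_ (card_filter_range_lt (M := 0) (Nat.zero_le k) (by omega) ⟨h3, h4⟩)
      omega
    · refine (Nat.add_le_add_right hn' 1).trans
        (card_filter_range_lt (k := k) ?_ (by omega) ⟨h3, h4⟩)
      have hm := stepIndex_mono T hb'.2
      by_contra hlt
      have e1 : k = stepIndex T a := by omega
      have e2 : k = stepIndex T b' := by omega
      obtain ⟨a1, a2, a3⟩ := stepIndex_spec hT ha
      obtain ⟨b1, b2, b3⟩ := stepIndex_spec hT (u := b') ⟨hb'.1, hb'.2.trans ha.2⟩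
      rw [← e1] at a1 a3
      rw [← e2] at b2
      have := h.backward_down k a1 (by omega) b' a hb'.2 b2 a3
      linarith

theorem FollowsPath.hasDowncrossings_card (h : FollowsPath f T δ c y) {j : ℤ}
    (hlo : δ * j < lo) (hhi : hi ≤ δ * (j + 1)) {K : ℕ} (hK : K ≤ T) :
    HasDowncrossings f lo hi #{k ∈ range K | y k = j + 1 ∧ y (k + 1) = j} (K / T) := by
  induction K with
  | zero => simp [HasDowncrossings]
  | succ K ih =>
    rw [range_add_one, filter_insert]
    have hle : (K : ℝ) / T ≤ ((K + 1 : ℕ) : ℝ) / T := by gcongr; omega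
    split_ifs with hk
    · rw [card_insert_of_notMem (by simp)]
      refine ⟨_, _, ih (by omega), hle, le_rfl, ?_, ?_⟩
      · rw [h.apply_node K (by omega), hk.1]
        exact_mod_cast hhi
      · rwa [h.apply_node (K + 1) hK, hk.2]
    · exact (ih (by omega)).mono hle

theorem FollowsPath.exists_double_down_step (h : FollowsPath f T δ c y) (hT : 0 < T) (hδ : 0 < δ)
    {j : ℤ} (hhi : δ * (j + 1) < hi) (hlo : lo ≤ δ * (j + 1)) {a b : ℝ}
    (ha : a ∈ Set.Icc (0 : ℝ) 1) (hb : b ∈ Set.Icc (0 : ℝ) 1) (hab : a ≤ b) (hfa : hi ≤ f a)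
    (hfb : f b < lo) :
    ∃ k, stepIndex T a ≤ k ∧ k < stepIndex T b ∧
      y k = j + 2 ∧ y (k + 1) = j + 1 ∧ y (k + 2) = j := by
  obtain ⟨a1, a2, a3⟩ := stepIndex_spec hT ha
  obtain ⟨b1, b2, b3⟩ := stepIndex_spec hT hb
  have hmono := stepIndex_mono T hab
  have hA : j + 1 < max (y (stepIndex T a)) (y (stepIndex T a + 1)) := by
    have := lt_of_lt_of_le (hhi.trans_le hfa) (h.mem_edge _ a1 a a2 a3).2
    exact_mod_cast lt_of_mul_lt_mul_left this hδ.le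
  have hB : min (y (stepIndex T b)) (y (stepIndex T b + 1)) < j + 1 := by
    have := lt_of_le_of_lt (h.mem_edge _ b1 b b2 b3).1 (hfb.trans_le hlo)
    exact_mod_cast lt_of_mul_lt_mul_left this hδ.le
  have hlt : stepIndex T a < stepIndex T b := by
    refine lt_of_le_of_ne hmono fun heq => ?_
    rw [heq] at hA
    have := h.succ_eq_or (stepIndex T b)
    omega
  obtain ⟨p, hp, hp', hyp⟩ : ∃ p, stepIndex T a ≤ p ∧ p ≤ stepIndex T a + 1 ∧ j + 2 ≤ y p := by
    rcases lt_max_iff.1 hA with hA | hA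
    exacts [⟨_, le_rfl, by omega, by omega⟩, ⟨_, by omega, le_rfl, by omega⟩]
  obtain ⟨q, hq, hq', hyq⟩ : ∃ q, stepIndex T b ≤ q ∧ q ≤ stepIndex T b + 1 ∧ y q ≤ j := by
    rcases min_lt_iff.1 hB with hB | hB
    exacts [⟨_, le_rfl, by omega, by omega⟩, ⟨_, by omega, le_rfl, by omega⟩]
  obtain ⟨k, h1, h2, h3⟩ := _root_.exists_double_down_step h.succ_eq_or j p q (by omega) hyp hyq
  exact ⟨k, by omega, by omega, h3⟩

theorem FollowsPath.card_le_of_hasDowncrossings' (h : FollowsPath f T δ c y) (hT : 0 < T)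
    (hδ : 0 < δ) {j : ℤ} (hhi : δ * (j + 1) < hi) (hlo : lo ≤ δ * (j + 1))
    {n : ℕ} {s : ℝ} (hs : s ≤ 1) (hn : HasDowncrossings f lo hi n s) :
    n ≤ #{k ∈ range (stepIndex T s) | y k = j + 2 ∧ y (k + 1) = j + 1 ∧ y (k + 2) = j} := by
  induction n generalizing s with
  | zero => exact Nat.zero_le _
  | succ n ih =>
    obtain ⟨a, b, hna, hab, hbs, hfa, hfb⟩ := hn
    have ha0 := hna.nonneg
    obtain ⟨k, h1, h2, h3⟩ := h.exists_double_down_step hT hδ hhi hlo (a := a) (b := b)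
      ⟨ha0, by linarith⟩ ⟨by linarith, by linarith⟩ hab hfa hfb
    exact (Nat.add_le_add_right (ih (by linarith) hna) 1).trans
      (card_filter_range_lt h1 (h2.trans_le (stepIndex_mono T hbs)) h3)

theorem FollowsPath.hasDowncrossings_card' (h : FollowsPath f T δ c y) {j : ℤ}
    (hlo : δ * j < lo) (hhi : hi ≤ δ * (j + 2)) {K : ℕ} (hK : K + 1 ≤ T) :
    HasDowncrossings f lo hi
      #{k ∈ range K | y k = j + 2 ∧ y (k + 1) = j + 1 ∧ y (k + 2) = j} ((K + 1 : ℕ) / T) := by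
  induction K using Nat.strong_induction_on with
  | _ K ih =>
    rcases K with _ | K
    · simp only [range_zero, filter_empty, card_empty, HasDowncrossings]
      positivity
    rw [range_add_one, filter_insert]
    split_ifs with hk
    · rw [card_insert_of_notMem (by simp)]
      refine ⟨(K : ℝ) / T, (K + 1 + 1 : ℕ) / T, ?_, ?_, le_rfl, ?_, ?_⟩
      · rcases K with _ | K
        · simp [HasDowncrossings]
        · rw [range_add_one, filter_insert, if_neg (by omega)]
          exact ih K (by omega) (by omega)
      · gcongr
        omega
      · rw [h.apply_node K (by omega), hk.1]
        exact_mod_cast hhi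
      · rwa [h.apply_node (K + 1 + 1) hK, hk.2.2]
    · exact (ih K (by omega) (by omega)).mono (by gcongr; omega)

end Counting

section CrossTimes

variable {f : ℝ → ℝ} {t z c : ℝ}

theorem hitTime_le {a : EReal} {P : ℝ → Prop} {u : ℝ} (h1 : a ≤ u) (h2 : u ≤ t) (h3 : P (f u)) :
    hitTime f t a P ≤ u :=
  sInf_le ⟨u, ⟨h1, h2, h3⟩, rfl⟩

theorem le_hitTime (a : EReal) (P : ℝ → Prop) : a ≤ hitTime f t a P :=
  le_sInf (by rintro _ ⟨u, hu, rfl⟩; exact hu.1)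

theorem exists_of_hitTime_le {a : EReal} {P : ℝ → Prop} {C : Set ℝ} (hf : ContinuousOn f (Set.Icc 0 t))
    (ha : 0 ≤ a) (hC : IsClosed C) (hPC : ∀ y, P y → y ∈ C) {v : ℝ} (hv : v ∈ Set.Icc 0 t)
    (hle : hitTime f t a P ≤ v) (hvC : f v ∉ C) : ∃ u : ℝ, 0 ≤ u ∧ a ≤ u ∧ u < v ∧ P (f u) := by
  by_contra! hcon
  have hev : ∀ᶠ u in nhdsWithin v (Set.Icc 0 t), f u ∉ C :=
    (hf v hv).eventually (hC.isOpen_compl.mem_nhds hvC)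
  obtain ⟨ε, hε, hball⟩ := Metric.mem_nhdsWithin_iff.1 hev
  have hge : ((v + ε : ℝ) : EReal) ≤ hitTime f t a P := by
    refine le_sInf ?_
    rintro _ ⟨u, ⟨h1, h2, h3⟩, rfl⟩
    have h0 : 0 ≤ u := by exact_mod_cast ha.trans h1
    by_contra! hlt
    have hlt' : u < v + ε := by exact_mod_cast hlt
    have hvu : v ≤ u := by
      by_contra! h
      exact hcon u h0 h1 h h3
    refine hball ⟨?_, h0, h2⟩ (hPC _ h3)
    rw [Metric.mem_ball, Real.dist_eq, abs_of_nonneg (by linarith)]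
    linarith
  have : v + ε ≤ v := by exact_mod_cast hge.trans hle
  linarith

theorem crossTimes_nonneg (n : ℕ) : 0 ≤ (crossTimes f z c t n).1 ∧ 0 ≤ (crossTimes f z c t n).2 := by
  induction n with
  | zero => exact ⟨le_rfl, le_hitTime _ _⟩
  | succ n ih =>
    have h := ih.2.trans (le_hitTime (f := f) (t := t) _ (fun y => y < z - c / 2))
    exact ⟨h, h.trans (le_hitTime _ _)⟩

theorem crossTimes_le_of_hasDowncrossings {n : ℕ} {s : ℝ} (hs : s ≤ t)
    (h : HasDowncrossings f (z - c / 2) (z + c / 2) n s) : (crossTimes f z c t n).1 ≤ s := by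
  induction n generalizing s with
  | zero => exact EReal.coe_nonneg.2 h
  | succ n ih =>
    obtain ⟨a, b, h1, h2, h3, h4, h5⟩ := h
    have hτ : (crossTimes f z c t n).2 ≤ a := by
      have := ih (h2.trans (h3.trans hs)) h1
      cases n <;> exact hitTime_le this (h2.trans (h3.trans hs)) h4
    have hb : (crossTimes f z c t (n + 1)).1 ≤ b :=
      hitTime_le (P := fun y => y < z - c / 2) (hτ.trans (by exact_mod_cast h2)) (h3.trans hs) h5
    exact hb.trans (by exact_mod_cast h3)

theorem hasDowncrossings_of_crossTimes_le (hf : ContinuousOn f (Set.Icc 0 t)) (hc : 0 < c) (n : ℕ) :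
    (∀ v ∈ Set.Icc 0 t, (crossTimes f z c t n).1 ≤ v → z + c / 2 ≤ f v →
      HasDowncrossings f (z - c / 2) (z + c / 2) n v) ∧
    (∀ v ∈ Set.Icc 0 t, (crossTimes f z c t n).2 ≤ v → f v < z - c / 2 →
      HasDowncrossings f (z - c / 2) (z + c / 2) (n + 1) v) := by
  have key : ∀ n, (∀ v ∈ Set.Icc 0 t, (crossTimes f z c t n).1 ≤ v → z + c / 2 ≤ f v →
      HasDowncrossings f (z - c / 2) (z + c / 2) n v) →
    (∀ v ∈ Set.Icc 0 t, (crossTimes f z c t n).2 ≤ v → f v < z - c / 2 →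
      HasDowncrossings f (z - c / 2) (z + c / 2) (n + 1) v) := by
    intro n hn v hv hle hfv
    have hle' : hitTime f t (crossTimes f z c t n).1 (fun y => z + c / 2 ≤ y) ≤ v := by
      cases n <;> exact hle
    obtain ⟨u, h0, h1, h2, h3⟩ := exists_of_hitTime_le hf (crossTimes_nonneg n).1
      (isClosed_Ici (a := z + c / 2)) (fun y hy => hy) hv hle' (by simp; linarith)
    exact ⟨u, v, hn u ⟨h0, h2.le.trans hv.2⟩ h1 h3, h2.le, le_rfl, h3, hfv⟩
  induction n with
  | zero => exact ⟨fun v hv _ _ => hv.1, key 0 (fun v hv _ _ => hv.1)⟩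
  | succ n ih =>
    have h : ∀ v ∈ Set.Icc 0 t, (crossTimes f z c t (n + 1)).1 ≤ v → z + c / 2 ≤ f v →
        HasDowncrossings f (z - c / 2) (z + c / 2) (n + 1) v := by
      intro v hv hle hfv
      obtain ⟨u, h0, h1, h2, h3⟩ := exists_of_hitTime_le hf (crossTimes_nonneg n).2
        (P := fun y => y < z - c / 2) (isClosed_Iic (a := z - c / 2))
        (fun y hy => le_of_lt hy) hv hle (by simp; linarith)
      exact (ih.2 u ⟨h0, h2.le.trans hv.2⟩ h1 h3).mono h2.le
    exact ⟨h, key _ h⟩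

theorem crossTimes_le_iff (hf : ContinuousOn f (Set.Icc 0 t)) (ht : 0 ≤ t) (hc : 0 < c) (n : ℕ) :
    (crossTimes f z c t n).1 ≤ t ↔ HasDowncrossings f (z - c / 2) (z + c / 2) n t := by
  refine ⟨fun h => ?_, crossTimes_le_of_hasDowncrossings le_rfl⟩
  cases n with
  | zero => exact ht
  | succ n =>
    have hne : ∃ u : ℝ, (crossTimes f z c t n).2 ≤ u ∧ u ≤ t ∧ f u < z - c / 2 := by
      by_contra! hcon
      refine absurd h (not_le_of_gt (lt_of_lt_of_le (EReal.coe_lt_top t) (le_sInf ?_)))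
      rintro _ ⟨u, ⟨h1, h2, h3⟩, rfl⟩
      exact absurd h3 (not_lt_of_ge (hcon u h1 h2))
    obtain ⟨u, h1, h2, h3⟩ := hne
    have h0 : 0 ≤ u := by exact_mod_cast (crossTimes_nonneg n).2.trans h1
    exact ((hasDowncrossings_of_crossTimes_le hf hc n).2 u ⟨h0, h2⟩ h1 h3).mono h2

variable {T : ℕ} {δ : ℝ} {y : ℕ → ℤ}

theorem FollowsPath.le_downCross_iff (h : FollowsPath f T δ c y) (hT : 0 < T) (hδ : 0 < δ)
    (hf : ContinuousOn f (Set.Icc 0 t)) (ht : t ∈ Set.Icc (0 : ℝ) 1) (hc : 0 < c) (n : ℕ) :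
    n ≤ downCross f z c t ↔ HasDowncrossings f (z - c / 2) (z + c / 2) n t := by
  have hset : {n : ℕ | (crossTimes f z c t n).1 ≤ (t : EReal)} =
      {n | HasDowncrossings f (z - c / 2) (z + c / 2) n t} :=
    Set.ext fun n => crossTimes_le_iff hf ht.1 hc n
  have hbdd : BddAbove {n | HasDowncrossings f (z - c / 2) (z + c / 2) n t} := by
    refine ⟨_, fun n hn => h.card_le_of_hasDowncrossings hT hδ (by linarith)
      (j := ⌊(z - c / 2) / δ⌋) ?_ ?_ ht.2 hn⟩
    · have := Int.floor_le ((z - c / 2) / δ)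
      rw [le_div_iff₀ hδ] at this
      linarith
    · have := Int.lt_floor_add_one ((z - c / 2) / δ)
      rw [div_lt_iff₀ hδ] at this
      linarith
  rw [downCross, hset]
  refine ⟨fun hn => ?_, fun hn => le_csSup hbdd hn⟩
  exact HasDowncrossings.of_le (Nat.sSup_mem ⟨0, ht.1⟩ hbdd) hn

theorem measurableSet_of_left_nhds {S : Set ℝ} (hS : ∀ z ∈ S, ∃ w < z, Set.Ioc w z ⊆ S) :
    MeasurableSet S := by
  choose! w hw hwS using hS
  have hint : ∀ z ∈ S, Set.Ioo (w z) z ⊆ interior S := fun z hz =>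
    interior_maximal (Set.Ioo_subset_Ioc_self.trans (hwS z hz)) isOpen_Ioo
  have hdisj : (S \ interior S).PairwiseDisjoint fun z => Set.Ioo (w z) z := by
    have key : ∀ a ∈ S \ interior S, ∀ b ∈ S \ interior S, a < b →
        Disjoint (Set.Ioo (w a) a) (Set.Ioo (w b) b) := by
      intro a ha b hb hab
      refine Set.disjoint_left.2 fun v hva hvb => ha.2 (hint b hb.1 ⟨hvb.1.trans hva.2, hab⟩)
    intro a ha b hb hab
    rcases lt_or_gt_of_ne hab with h | h
    exacts [key a ha b hb h, (key b hb a ha h).symm]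
  have hcount : (S \ interior S).Countable := by
    have := Set.PairwiseDisjoint.countable_of_Ioo (α := ℝ) (s := Neg.neg '' (S \ interior S))
      (y := fun a => - w (-a)) ?_ ?_
    · simpa using this.image Neg.neg
    · rw [Set.PairwiseDisjoint, (neg_injective.injOn).pairwise_image]
      intro a ha b hb hab
      have := hdisj ha hb hab
      simp only [Function.onFun, Set.disjoint_left] at this ⊢
      intro v hva hvb
      simp only [Set.mem_Ioo, neg_neg] at hva hvb
      exact this (a := -v) ⟨by linarith, by linarith⟩ ⟨by linarith, by linarith⟩
    · rintro _ ⟨a, ha, rfl⟩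
      simpa using hw a ha.1
  rw [← Set.union_sdiff_cancel (interior_subset (s := S))]
  exact isOpen_interior.measurableSet.union hcount.measurableSet

theorem measurableSet_hasDowncrossings (n : ℕ) (s : ℝ) :
    MeasurableSet {z | HasDowncrossings f (z - c / 2) (z + c / 2) n s} := by
  apply measurableSet_of_left_nhds
  intro z hz
  simp only [Set.mem_ofPred_eq] at hz
  induction n generalizing s with
  | zero => exact ⟨z - 1, by linarith, fun _ _ => hz⟩
  | succ n ih =>
    obtain ⟨a, b, h1, h2, h3, h4, h5⟩ := hz
    obtain ⟨w, hw, hwS⟩ := ih a h1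
    refine ⟨max w (f b + c / 2), max_lt hw (by linarith), fun v hv => ?_⟩
    obtain ⟨hv1, hv2⟩ := max_lt_iff.1 hv.1
    exact ⟨a, b, hwS ⟨hv1, hv.2⟩, h2, h3, by linarith [hv.2], by linarith⟩

theorem FollowsPath.measurable_downCross (h : FollowsPath f T δ c y) (hT : 0 < T) (hδ : 0 < δ)
    (hf : ContinuousOn f (Set.Icc 0 t)) (ht : t ∈ Set.Icc (0 : ℝ) 1) (hc : 0 < c) :
    Measurable fun z => downCross f z c t := by
  refine measurable_of_Ici fun n => ?_
  convert! measurableSet_hasDowncrossings (f := f) (c := c) n t using 1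
  ext z
  exact h.le_downCross_iff hT hδ hf ht hc n

theorem FollowsPath.measurable_crossCount (h : FollowsPath f T δ c y) (hT : 0 < T) (hδ : 0 < δ)
    (hf : ContinuousOn f (Set.Icc 0 t)) (ht : t ∈ Set.Icc (0 : ℝ) 1) (hc : 0 < c) :
    Measurable fun z => crossCount f z c t :=
  ((h.neg.measurable_downCross hT hδ hf.neg ht hc).comp measurable_neg).add
    (h.measurable_downCross hT hδ hf ht hc)

theorem FollowsPath.downCross_eq_zero (h : FollowsPath f T δ c y) (hT : 0 < T) (hδ : 0 < δ)
    (hf : ContinuousOn f (Set.Icc 0 t)) (ht : t ∈ Set.Icc (0 : ℝ) 1) (hc : 0 < c) {r s : ℝ}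
    (hrs : ∀ u ∈ Set.Icc (0 : ℝ) 1, f u ∈ Set.Icc r s) (hz : z ∉ Set.Icc r s) :
    downCross f z c t = 0 := by
  by_contra hne
  obtain ⟨a, b, h1, h2, h3, h4, h5⟩ :=
    (h.le_downCross_iff hT hδ hf ht hc (z := z) 1).1 (Nat.one_le_iff_ne_zero.2 hne)
  have h0 := h1.nonneg
  have ha := hrs a ⟨h0, by linarith [ht.2]⟩
  have hb := hrs b ⟨by linarith, by linarith [ht.2]⟩
  exact hz ⟨by linarith [hb.1], by linarith [ha.2]⟩

theorem FollowsPath.crossCount_eq_zero (h : FollowsPath f T δ c y) (hT : 0 < T) (hδ : 0 < δ)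
    (hf : ContinuousOn f (Set.Icc 0 t)) (ht : t ∈ Set.Icc (0 : ℝ) 1) (hc : 0 < c) {r s : ℝ}
    (hrs : ∀ u ∈ Set.Icc (0 : ℝ) 1, f u ∈ Set.Icc r s) (hz : z ∉ Set.Icc r s) :
    crossCount f z c t = 0 := by
  rw [crossCount, upCross, h.downCross_eq_zero hT hδ hf ht hc hrs hz,
    h.neg.downCross_eq_zero hT hδ hf.neg ht hc (r := -s) (s := -r)]
  · intro u hu
    have := hrs u hu
    exact ⟨by linarith [this.2], by linarith [this.1]⟩
  · intro h
    exact hz ⟨by linarith [h.2], by linarith [h.1]⟩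

theorem stepIndex_le_floor (T : ℕ) (t : ℝ) : stepIndex T t ≤ ⌊(T : ℝ) * t⌋₊ := min_le_left _ _

theorem floor_mul_le {T : ℕ} (ht : t ∈ Set.Icc (0 : ℝ) 1) : ⌊(T : ℝ) * t⌋₊ ≤ T :=
  Nat.floor_le_of_le (mul_le_of_le_one_right (Nat.cast_nonneg T) ht.2)

theorem floor_div_le {T : ℕ} (hT : 0 < T) (ht : t ∈ Set.Icc (0 : ℝ) 1) {K : ℕ}
    (hK : K ≤ ⌊(T : ℝ) * t⌋₊) : (K : ℝ) / T ≤ t := by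
  have hT' : (0 : ℝ) < T := by exact_mod_cast hT
  rw [div_le_iff₀ hT', mul_comm]
  exact (Nat.le_floor_iff (mul_nonneg hT'.le ht.1)).1 hK

open Finset

theorem FollowsPath.downCross_bounds (h : FollowsPath f T δ c y) (hT : 0 < T) (hδ : 0 < δ)
    (hf : ContinuousOn f (Set.Icc 0 t)) (ht : t ∈ Set.Icc (0 : ℝ) 1) (hc : 0 < c) {j : ℤ}
    (hlo : δ * j < z - c / 2) (hhi : z + c / 2 < δ * (j + 1)) :
    #{k ∈ range ⌊(T : ℝ) * t⌋₊ | y k = j + 1 ∧ y (k + 1) = j} ≤ downCross f z c t ∧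
      downCross f z c t ≤ #{k ∈ range ⌊(T : ℝ) * t⌋₊ | y k = j + 1 ∧ y (k + 1) = j} + 1 := by
  refine ⟨(h.le_downCross_iff hT hδ hf ht hc _).2
    ((h.hasDowncrossings_card hlo hhi.le (floor_mul_le ht)).mono (floor_div_le hT ht le_rfl)), ?_⟩
  refine (h.card_le_of_hasDowncrossings hT hδ (by linarith) (j := j) (by linarith) (by linarith)
    ht.2 ((h.le_downCross_iff hT hδ hf ht hc _).1 le_rfl)).trans ?_
  exact (card_filter_range_mono (Nat.add_le_add_right (stepIndex_le_floor T t) 1)).trans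
    card_filter_range_succ_le

theorem FollowsPath.downCross_bounds' (h : FollowsPath f T δ c y) (hT : 0 < T) (hδ : 0 < δ)
    (hf : ContinuousOn f (Set.Icc 0 t)) (ht : t ∈ Set.Icc (0 : ℝ) 1) (hc : 0 < c) {j : ℤ}
    (hlo : δ * j < z - c / 2) (hlo' : z - c / 2 < δ * (j + 1)) (hhi' : δ * (j + 1) < z + c / 2)
    (hhi : z + c / 2 < δ * (j + 2)) :
    #{k ∈ range ⌊(T : ℝ) * t⌋₊ | y k = j + 2 ∧ y (k + 1) = j + 1 ∧ y (k + 2) = j} ≤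
        downCross f z c t + 1 ∧
      downCross f z c t ≤
        #{k ∈ range ⌊(T : ℝ) * t⌋₊ | y k = j + 2 ∧ y (k + 1) = j + 1 ∧ y (k + 2) = j} := by
  constructor
  · rcases hK : ⌊(T : ℝ) * t⌋₊ with _ | K
    · simp
    refine card_filter_range_succ_le.trans (Nat.add_le_add_right ?_ 1)
    have hKT := floor_mul_le (T := T) ht
    exact (h.le_downCross_iff hT hδ hf ht hc _).2
      ((h.hasDowncrossings_card' hlo hhi.le (by omega)).mono (floor_div_le hT ht hK.ge))
  · refine (h.card_le_of_hasDowncrossings' hT hδ (j := j) hhi' hlo'.le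
      ht.2 ((h.le_downCross_iff hT hδ hf ht hc _).1 le_rfl)).trans ?_
    exact card_filter_range_mono (stepIndex_le_floor T t)

/-- The number of crossings of `[z - c / 2, z + c / 2]` by the first `K` steps of the path `δ * y`:
either the interval lies inside an edge, or it contains one node in its interior. -/
def pathCrossCount (δ c : ℝ) (y : ℕ → ℤ) (K : ℕ) (z : ℝ) : ℝ :=
  ∑ k ∈ range K,
    ((Set.Ioo (δ * (min (y k) (y (k + 1)) : ℤ) + c / 2)
        (δ * ((min (y k) (y (k + 1)) : ℤ) + 1) - c / 2)).indicator 1 z +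
      (if y k = y (k + 2) then 0 else 1) *
        (Set.Ioo (δ * y (k + 1) - c / 2) (δ * y (k + 1) + c / 2)).indicator 1 z)

theorem card_filter_eq_add {s : Finset ℕ} {P Q R : ℕ → Prop} [DecidablePred P] [DecidablePred Q]
    [DecidablePred R] (h : ∀ k, R k ↔ P k ∨ Q k) (hd : ∀ k, P k → ¬ Q k) :
    #{k ∈ s | R k} = #{k ∈ s | P k} + #{k ∈ s | Q k} := by
  rw [← card_union_of_disjoint (disjoint_filter.2 fun k _ => hd k), ← filter_or]
  congr 1
  exact filter_congr fun k _ => h k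

theorem FollowsPath.abs_crossCount_sub_le (h : FollowsPath f T δ c y) (hT : 0 < T) (hδ : 0 < δ)
    (hf : ContinuousOn f (Set.Icc 0 t)) (ht : t ∈ Set.Icc (0 : ℝ) 1) (hc : 0 < c) (hcδ : c ≤ δ)
    (hz1 : ∀ j : ℤ, z - c / 2 ≠ δ * j) (hz2 : ∀ j : ℤ, z + c / 2 ≠ δ * j) :
    |(crossCount f z c t : ℝ) - pathCrossCount δ c y ⌊(T : ℝ) * t⌋₊ z| ≤ 2 := by
  obtain ⟨j, hj1, hj2⟩ : ∃ j : ℤ, δ * j < z - c / 2 ∧ z - c / 2 < δ * (j + 1) := by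
    refine ⟨⌊(z - c / 2) / δ⌋, ?_, ?_⟩
    · have := Int.floor_le ((z - c / 2) / δ)
      rw [le_div_iff₀ hδ, mul_comm] at this
      exact lt_of_le_of_ne this (hz1 _).symm
    · have := Int.lt_floor_add_one ((z - c / 2) / δ)
      rw [div_lt_iff₀ hδ] at this
      linarith
  have cancel : ∀ i i' : ℤ, δ * (i : ℝ) < δ * i' → i < i' := fun i i' hi => by
    exact_mod_cast lt_of_mul_lt_mul_left hi hδ.le
  have hy := h.succ_eq_or
  have hy' : ∀ k, y (k + 2) = y (k + 1) + 1 ∨ y (k + 2) = y (k + 1) - 1 := fun k => hy (k + 1)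
  set K := ⌊(T : ℝ) * t⌋₊ with hK
  rcases lt_or_gt_of_ne (hz2 (j + 1)) with hlt | hgt
  · push_cast at hlt
    have hcount : pathCrossCount δ c y K z = #{k ∈ range K | min (y k) (y (k + 1)) = j} := by
      rw [pathCrossCount, card_filter, Nat.cast_sum]
      refine sum_congr rfl fun k _ => ?_
      rw [Set.indicator_of_notMem (s := Set.Ioo (δ * (y (k + 1) : ℝ) - c / 2) _), mul_zero,
        add_zero]
      · by_cases he : min (y k) (y (k + 1)) = j
        · rw [Set.indicator_of_mem, if_pos he]
          · simp
          · rw [he]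
            exact ⟨by linarith, by linarith⟩
        · rw [Set.indicator_of_notMem, if_neg he]
          · simp
          · intro hm
            have h1 := cancel (min (y k) (y (k + 1))) (j + 1) (by push_cast at hm ⊢; linarith [hm.1])
            have h2 := cancel j (min (y k) (y (k + 1)) + 1) (by push_cast at hm ⊢; linarith [hm.2])
            omega
      · intro hm
        have h1 := cancel (y (k + 1)) (j + 1) (by push_cast; linarith [hm.1])
        have h2 := cancel j (y (k + 1)) (by linarith [hm.2])
        omega
    have hd := h.downCross_bounds hT hδ hf ht hc hj1 hlt
    have hu := h.neg.downCross_bounds hT hδ hf.neg ht hc (z := -z) (j := -j - 1)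
      (by push_cast; linarith) (by push_cast; linarith)
    rw [hcount, card_filter_eq_add (s := range K) (P := fun k => -y k = -j - 1 + 1 ∧ -y (k + 1) = -j - 1)
      (Q := fun k => y k = j + 1 ∧ y (k + 1) = j) (fun k => by have := hy k; omega)
      (fun k => by omega), crossCount, upCross]
    rw [← hK] at hd hu
    rw [abs_le]
    constructor
    · rw [le_sub_iff_add_le', ← sub_eq_add_neg, sub_le_iff_le_add]
      exact_mod_cast (by omega)
    · rw [sub_le_iff_le_add]
      exact_mod_cast (by omega)
  · push_cast at hgt
    have hcount : pathCrossCount δ c y K z =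
        #{k ∈ range K | y k ≠ y (k + 2) ∧ y (k + 1) = j + 1} := by
      rw [pathCrossCount, card_filter, Nat.cast_sum]
      refine sum_congr rfl fun k _ => ?_
      rw [Set.indicator_of_notMem (s := Set.Ioo (δ * (min (y k) (y (k + 1)) : ℤ) + c / 2) _),
        zero_add]
      · by_cases he : y (k + 1) = j + 1
        · rw [Set.indicator_of_mem]
          · by_cases hk : y k = y (k + 2) <;> simp [he, hk]
          · rw [he]
            push_cast
            exact ⟨by linarith, by linarith⟩
        · rw [Set.indicator_of_notMem]
          · simp [he]
          · intro hm
            have h1 := cancel (y (k + 1)) (j + 2) (by push_cast; linarith [hm.1])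
            have h2 := cancel j (y (k + 1)) (by linarith [hm.2])
            omega
      · intro hm
        have h1 := cancel (min (y k) (y (k + 1))) (j + 1) (by push_cast at hm ⊢; linarith [hm.1])
        have h2 := cancel (j + 1) (min (y k) (y (k + 1)) + 1) (by push_cast at hm ⊢; linarith [hm.2])
        omega
    have hd := h.downCross_bounds' hT hδ hf ht hc hj1 hj2 hgt (by linarith)
    have hu := h.neg.downCross_bounds' hT hδ hf.neg ht hc (z := -z) (j := -j - 2)
      (by push_cast; linarith) (by push_cast; linarith) (by push_cast; linarith)
      (by push_cast; linarith)
    rw [hcount, card_filter_eq_add (s := range K)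
      (P := fun k => -y k = -j - 2 + 2 ∧ -y (k + 1) = -j - 2 + 1 ∧ -y (k + 2) = -j - 2)
      (Q := fun k => y k = j + 2 ∧ y (k + 1) = j + 1 ∧ y (k + 2) = j)
      (fun k => by have := hy k; have := hy' k; omega)
      (fun k => by omega), crossCount, upCross]
    rw [← hK] at hd hu
    rw [abs_le]
    constructor
    · rw [le_sub_iff_add_le', ← sub_eq_add_neg, sub_le_iff_le_add]
      exact_mod_cast (by omega)
    · rw [sub_le_iff_le_add]
      exact_mod_cast (by omega)

end CrossTimes

section Limit

open Finset

/-- The indicator that the path goes straight through its node `k + 1`, without turning. -/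
def straight (k : ℕ) : ℝ := if height k = height (k + 2) then 0 else 1

theorem straight_nonneg (k : ℕ) : 0 ≤ straight k := by
  unfold straight; split_ifs <;> norm_num

theorem straight_le_one (k : ℕ) : straight k ≤ 1 := by
  unfold straight; split_ifs <;> norm_num

theorem straight_eq (k : ℕ) : straight k = if stepSign k + stepSign (k + 1) = 0 then 0 else 1 := by
  rw [straight, height_succ (k + 1), height_succ k]
  congr 1
  apply propext
  omega

theorem sum_straight_nine_mul (k : ℕ) :
    ∑ i ∈ range 9, straight (9 * k + i) = 2 + straight k := by
  have h0 := stepSign_nine_mul k 0 (by norm_num)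
  have h1 := stepSign_nine_mul k 1 (by norm_num)
  have h2 := stepSign_nine_mul k 2 (by norm_num)
  have h3 := stepSign_nine_mul k 3 (by norm_num)
  have h4 := stepSign_nine_mul k 4 (by norm_num)
  have h5 := stepSign_nine_mul k 5 (by norm_num)
  have h6 := stepSign_nine_mul k 6 (by norm_num)
  have h7 := stepSign_nine_mul k 7 (by norm_num)
  have h8 := stepSign_nine_mul k 8 (by norm_num)
  have h9 := stepSign_nine_mul (k + 1) 0 (by norm_num)
  norm_num [Nat.odd_iff] at h0 h1 h2 h3 h4 h5 h6 h7 h8 h9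
  rw [show 9 * (k + 1) = 9 * k + 8 + 1 by ring] at h9
  simp only [sum_range_succ, range_zero, sum_empty, straight_eq, add_assoc, Nat.reduceAdd,
    add_zero] at h9 ⊢
  rw [h0, h1, h2, h3, h4, h5, h6, h7, h8, h9]
  rcases stepSign_eq_or k with h | h <;> rcases stepSign_eq_or (k + 1) with h' | h' <;>
    rw [h, h'] <;> norm_num

theorem abs_height_nine_mul_add_sub_le (k i : ℕ) (hi : i < 9) :
    |height (9 * k + i) - 3 * height k| ≤ 3 := by
  have h := height_subdivision ⟨i / 3, by omega⟩ ⟨i % 3, by omega⟩ k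
  simp only at h
  rw [show 9 * k + 3 * (i / 3) + i % 3 = 9 * k + i by omega] at h
  rw [h, add_sub_cancel_left, abs_mul]
  have h1 : |stepSign k| = 1 := by rcases stepSign_eq_or k with h | h <;> simp [h]
  rw [h1, one_mul, abs_le]
  split_ifs <;> omega

/-- An affine contraction with asymptotically constant inhomogeneity converges. -/
theorem tendsto_of_tendsto_sub_div_nine {w : ℕ → ℝ} {β : ℝ}
    (h : Tendsto (fun m => w (m + 1) - w m / 9) atTop (nhds β)) :
    Tendsto w atTop (nhds (9 / 8 * β)) := by
  rw [Metric.tendsto_atTop] at h ⊢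
  intro ε hε
  obtain ⟨M, hM⟩ := h (ε / 3) (by positivity)
  have key : ∀ j, |w (M + j) - 9 / 8 * β| ≤ |w M - 9 / 8 * β| * (1 / 9) ^ j + 3 / 8 * ε := by
    intro j
    induction j with
    | zero => simp only [add_zero, pow_zero, mul_one]; linarith
    | succ j ih =>
      have h1 := (hM (M + j) (by omega)).le
      rw [Real.dist_eq] at h1
      have h2 : w (M + (j + 1)) - 9 / 8 * β =
          (w (M + j + 1) - w (M + j) / 9 - β) + (w (M + j) - 9 / 8 * β) / 9 := by
        rw [← add_assoc]; ring
      rw [h2]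
      refine (abs_add_le _ _).trans ?_
      rw [abs_div, abs_of_pos (show (0 : ℝ) < 9 by norm_num), pow_succ]
      linarith
  have h0 : Tendsto (fun j : ℕ => |w M - 9 / 8 * β| * (1 / 9 : ℝ) ^ j) atTop (nhds 0) := by
    simpa using (tendsto_pow_atTop_nhds_zero_of_lt_one (r := (1 / 9 : ℝ)) (by norm_num)
      (by norm_num)).const_mul |w M - 9 / 8 * β|
  obtain ⟨J, hJ⟩ := (h0.eventually (gt_mem_nhds (show 0 < ε / 2 by positivity))).exists_forall_of_atTop
  refine ⟨M + J, fun n hn => ?_⟩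
  obtain ⟨j, rfl⟩ : ∃ j, n = M + j := ⟨n - M, by omega⟩
  rw [Real.dist_eq]
  linarith [key j, hJ j (by omega)]

theorem FollowsPath.abs_sub_le {f : ℝ → ℝ} {T : ℕ} {δ c : ℝ} {y : ℕ → ℤ}
    (h : FollowsPath f T δ c y) (hδ : 0 ≤ δ) {k : ℕ} (hk : k < T) {u : ℝ}
    (h1 : (k : ℝ) ≤ T * u) (h2 : T * u ≤ k + 1) :
    |f u - δ * y k| ≤ δ ∧ |f u - δ * y (k + 1)| ≤ δ := by
  obtain ⟨h3, h4⟩ := h.mem_edge k hk u h1 h2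
  rcases h.succ_eq_or k with hy | hy
  · rw [min_eq_left (by omega)] at h3
    rw [max_eq_right (by omega)] at h4
    rw [hy] at h4 ⊢
    push_cast at *
    constructor <;> rw [abs_le] <;> constructor <;> linarith
  · rw [min_eq_right (by omega)] at h3
    rw [max_eq_left (by omega)] at h4
    rw [hy] at h3 ⊢
    push_cast at *
    constructor <;> rw [abs_le] <;> constructor <;> linarith

theorem IsPeanoX.followsPath_one (hx : IsPeanoX x) (m : ℕ) :
    FollowsPath x (9 ^ m) (1 / 3 ^ m) (1 / 3 ^ m) height :=
  hx.followsPath m (by gcongr; norm_num)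

theorem IsPeanoX.continuousOn (hx : IsPeanoX x) : ContinuousOn x (Set.Icc 0 1) := by
  rw [Metric.continuousOn_iff]
  intro v hv ε hε
  obtain ⟨m, hm⟩ := exists_pow_lt_of_lt_one (show 0 < ε / 2 by positivity)
    (show (1 / 3 : ℝ) < 1 by norm_num)
  rw [one_div_pow] at hm
  have h := hx.followsPath_one m
  have hT : 0 < 9 ^ m := by positivity
  have hδ : (0 : ℝ) ≤ 1 / 3 ^ m := by positivity
  have key : ∀ u ∈ Set.Icc (0 : ℝ) 1, ∀ v ∈ Set.Icc (0 : ℝ) 1, u ≤ v → v - u < 1 / 9 ^ m →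
      |x u - x v| < ε := by
    intro u hu v hv huv hd
    obtain ⟨u1, u2, u3⟩ := stepIndex_spec hT hu
    obtain ⟨v1, v2, v3⟩ := stepIndex_spec hT hv
    have hu' := h.abs_sub_le hδ u1 u2 u3
    have hv' := (h.abs_sub_le hδ v1 v2 v3).1
    have hd' : ((9 ^ m : ℕ) : ℝ) * (v - u) < 1 := by
      push_cast
      rwa [lt_div_iff₀ (by positivity), mul_comm] at hd
    have hle := stepIndex_le_add_one hT hu hv hd'
    have hge := stepIndex_mono (9 ^ m) huv
    rw [abs_le] at hv'
    rw [abs_lt]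
    rcases hge.lt_or_eq with hlt | heq
    · have hu'' := abs_le.1 hu'.2
      rw [show stepIndex (9 ^ m) v = stepIndex (9 ^ m) u + 1 by omega] at hv'
      constructor <;> linarith
    · have hu'' := abs_le.1 hu'.1
      rw [← heq] at hv'
      constructor <;> linarith
  refine ⟨1 / 9 ^ m, by positivity, fun u hu hd => ?_⟩
  rw [Real.dist_eq] at hd ⊢
  rcases le_total u v with huv | huv
  · exact key u hu v hv huv (by linarith [neg_abs_le (u - v)])
  · rw [abs_sub_comm]
    exact key v hv u hu huv (by linarith [le_abs_self (u - v)])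

theorem IsPeanoX.height_mem (hx : IsPeanoX x) (m k : ℕ) (hk : k ≤ 9 ^ m) :
    (height k : ℝ) / 3 ^ m ∈ Set.Icc (0 : ℝ) 1 := by
  rw [← hx.apply_node m k hk]
  refine hx.mem_Icc ⟨by positivity, ?_⟩
  rw [div_le_one (by positivity)]
  exact_mod_cast hk

theorem eventually_modulus {g : ℝ → ℝ} (hg : Continuous g) {η : ℝ} (hη : 0 < η) :
    ∀ᶠ m : ℕ in atTop, ∀ a ∈ Set.Icc (-1 : ℝ) 2, ∀ b ∈ Set.Icc (-1 : ℝ) 2,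
      |a - b| ≤ 2 / 3 ^ m → |g a - g b| ≤ η := by
  have hu := (isCompact_Icc (a := (-1 : ℝ)) (b := 2)).uniformContinuousOn_of_continuous
    hg.continuousOn
  rw [Metric.uniformContinuousOn_iff] at hu
  obtain ⟨d, hd, h⟩ := hu η hη
  have h0 : Tendsto (fun m : ℕ => 2 * (1 / 3 : ℝ) ^ m) atTop (nhds 0) := by
    simpa using (tendsto_pow_atTop_nhds_zero_of_lt_one (r := (1 / 3 : ℝ)) (by norm_num)
      (by norm_num)).const_mul 2
  filter_upwards [h0.eventually (gt_mem_nhds hd)] with m hm a ha b hb hab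
  rw [one_div_pow, mul_one_div] at hm
  exact (h a ha b hb (hab.trans_lt hm)).le

theorem exists_bound {g : ℝ → ℝ} (hg : Continuous g) :
    ∃ B, 0 ≤ B ∧ ∀ a ∈ Set.Icc (-1 : ℝ) 2, |g a| ≤ B := by
  obtain ⟨B, hB⟩ := (isCompact_Icc (a := (-1 : ℝ)) (b := 2)).exists_bound_of_continuousOn
    hg.continuousOn
  exact ⟨B, (norm_nonneg _).trans (hB 0 (by norm_num)), hB⟩

/-- The normalized sum of a weighted function over the nodes visited before time `t` at level `m`. -/
def nodeSum (r : ℕ → ℝ) (g : ℝ → ℝ) (t : ℝ) (m : ℕ) : ℝ :=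
  (∑ k ∈ range ⌊((9 ^ m : ℕ) : ℝ) * t⌋₊, r k * g (height k / 3 ^ m)) / 9 ^ m

theorem tendsto_of_eventually_le_add_div {u : ℕ → ℝ} {L B : ℝ}
    (h : ∀ η > 0, ∀ᶠ m : ℕ in atTop, |u m - L| ≤ η + B * (1 / 3) ^ m) :
    Tendsto u atTop (nhds L) := by
  have h0 : Tendsto (fun m : ℕ => B * (1 / 3 : ℝ) ^ m) atTop (nhds 0) := by
    simpa using (tendsto_pow_atTop_nhds_zero_of_lt_one (r := (1 / 3 : ℝ)) (by norm_num)
      (by norm_num)).const_mul B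
  rw [Metric.tendsto_nhds]
  intro ε hε
  filter_upwards [h (ε / 2) (by positivity), h0.eventually (gt_mem_nhds (half_pos hε))]
    with m h1 h2
  rw [Real.dist_eq]
  linarith

theorem one_div_nine_pow_le (m : ℕ) : 1 / (9 : ℝ) ^ m ≤ (1 / 3) ^ m := by
  rw [← one_div_pow]
  gcongr
  norm_num

variable {g : ℝ → ℝ} {t : ℝ}

theorem IsPeanoX.tendsto_nodeSum_one (hx : IsPeanoX x) (hg : Continuous g)
    (ht : t ∈ Set.Icc (0 : ℝ) 1) :
    Tendsto (nodeSum (fun _ => 1) g t) atTop (nhds (∫ s in (0 : ℝ)..t, g (x s))) := by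
  obtain ⟨B, hB0, hB⟩ := exists_bound hg
  have hsub : Set.Icc (0 : ℝ) 1 ⊆ Set.Icc (-1) 2 := Set.Icc_subset_Icc (by norm_num) (by norm_num)
  have hcont : ContinuousOn (fun s => g (x s)) (Set.Icc 0 1) := hg.comp_continuousOn hx.continuousOn
  have hint : ∀ a b, a ∈ Set.Icc (0 : ℝ) 1 → b ∈ Set.Icc (0 : ℝ) 1 →
      IntervalIntegrable (fun s => g (x s)) MeasureTheory.volume a b := fun a b ha hb =>
    (hcont.mono (Set.uIcc_subset_Icc ha hb)).intervalIntegrable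
  refine tendsto_of_eventually_le_add_div (B := B) fun η hη => ?_
  filter_upwards [eventually_modulus hg hη] with m hm
  set K := ⌊((9 ^ m : ℕ) : ℝ) * t⌋₊ with hK
  have h := hx.followsPath_one m
  have hT : 0 < 9 ^ m := by positivity
  have hKT : K ≤ 9 ^ m := floor_mul_le ht
  have h9 : (0 : ℝ) < 9 ^ m := by positivity
  have hnode : ∀ k ≤ K, (k : ℝ) / 9 ^ m ∈ Set.Icc (0 : ℝ) t := fun k hk =>
    ⟨by positivity, by exact_mod_cast floor_div_le hT ht hk⟩
  have hnode' : ∀ k ≤ K, (k : ℝ) / 9 ^ m ∈ Set.Icc (0 : ℝ) 1 := fun k hk =>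
    ⟨(hnode k hk).1, (hnode k hk).2.trans ht.2⟩
  have hlen : ∀ k : ℕ, ((k + 1 : ℕ) : ℝ) / 9 ^ m - k / 9 ^ m = 1 / 9 ^ m := fun k => by
    push_cast; ring
  have hsplit : ∫ s in (0 : ℝ)..t, g (x s) =
      ∑ k ∈ range K, (∫ s in ((k : ℝ) / 9 ^ m)..((k + 1 : ℕ) / 9 ^ m), g (x s)) +
        ∫ s in ((K : ℝ) / 9 ^ m)..t, g (x s) := by
    rw [intervalIntegral.sum_integral_adjacent_intervals (a := fun k : ℕ => (k : ℝ) / 9 ^ m)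
      (fun k hk => hint _ _ (hnode' k (by omega)) (hnode' (k + 1) (by omega)))]
    simp only [Nat.cast_zero, zero_div]
    rw [intervalIntegral.integral_add_adjacent_intervals
      (hint _ _ (by simp) (hnode' K le_rfl)) (hint _ _ (hnode' K le_rfl) ht)]
  have hstep : ∀ k ∈ range K,
      |1 * g (height k / 3 ^ m) / 9 ^ m -
        ∫ s in ((k : ℝ) / 9 ^ m)..((k + 1 : ℕ) / 9 ^ m), g (x s)| ≤ η / 9 ^ m := by
    intro k hk
    have hk' := mem_range.1 hk
    have e1 : 1 * g (height k / 3 ^ m) / 9 ^ m =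
        ∫ s in ((k : ℝ) / 9 ^ m)..((k + 1 : ℕ) / 9 ^ m), g (height k / 3 ^ m) := by
      rw [intervalIntegral.integral_const, hlen, smul_eq_mul]
      ring
    rw [e1, ← intervalIntegral.integral_sub (by simp)
      (hint _ _ (hnode' k (by omega)) (hnode' (k + 1) (by omega)))]
    have := intervalIntegral.norm_integral_le_of_norm_le_const (C := η)
      (a := (k : ℝ) / 9 ^ m) (b := (k + 1 : ℕ) / 9 ^ m)
      (f := fun s => g (height k / 3 ^ m) - g (x s)) ?_
    · rw [hlen, abs_of_nonneg (by positivity), Real.norm_eq_abs] at this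
      simpa [div_eq_mul_inv] using this
    · intro s hs
      rw [Set.uIoc_of_le (by gcongr; omega)] at hs
      have hs1 : s ∈ Set.Icc (0 : ℝ) 1 :=
        ⟨(hnode' k (by omega)).1.trans hs.1.le, hs.2.trans (hnode' (k + 1) (by omega)).2⟩
      refine hm _ (hsub (hx.height_mem m k (by omega))) _ (hsub (hx.mem_Icc hs1)) ?_
      have hs2 := hs.1.le
      have hs3 := hs.2
      rw [div_le_iff₀' h9] at hs2
      rw [le_div_iff₀' h9] at hs3
      push_cast at hs3
      have := (h.abs_sub_le (by positivity) (hk'.trans_le hKT) (u := s) (by push_cast; exact hs2)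
        (by push_cast; exact hs3)).1
      rw [abs_sub_comm, one_div_mul_eq_div] at this
      exact this.trans (by gcongr; norm_num)
  have hrest : |∫ s in ((K : ℝ) / 9 ^ m)..t, g (x s)| ≤ B * (1 / 9 ^ m) := by
    have hlt : t - K / 9 ^ m ≤ 1 / 9 ^ m := by
      have := (Nat.lt_floor_add_one (((9 ^ m : ℕ) : ℝ) * t)).le
      rw [← hK] at this
      push_cast at this
      rw [← mul_comm, ← le_div_iff₀ h9] at this
      rw [sub_le_iff_le_add, ← add_div, add_comm]
      exact this
    have := intervalIntegral.norm_integral_le_of_norm_le_const (C := B)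
      (a := (K : ℝ) / 9 ^ m) (b := t) (f := fun s => g (x s)) ?_
    · rw [Real.norm_eq_abs,
        abs_of_nonneg (a := t - K / 9 ^ m) (sub_nonneg.2 (hnode K le_rfl).2)] at this
      exact this.trans (by gcongr)
    · intro s hs
      rw [Set.uIoc_of_le (hnode K le_rfl).2] at hs
      exact hB _ (hsub (hx.mem_Icc ⟨(hnode K le_rfl).1.trans hs.1.le, hs.2.trans ht.2⟩))
  rw [nodeSum, ← hK, hsplit, sum_div, ← sub_sub, ← sum_sub_distrib]
  refine (abs_sub _ _).trans ?_
  have hsum : ∑ k ∈ range K, η / (9 : ℝ) ^ m ≤ η := by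
    rw [sum_const, card_range, nsmul_eq_mul, mul_div_assoc', div_le_iff₀ h9, mul_comm]
    have : (K : ℝ) ≤ 9 ^ m := by exact_mod_cast hKT
    gcongr
  exact add_le_add (((abs_sum_le_sum_abs _ _).trans (sum_le_sum hstep)).trans hsum)
    (hrest.trans (mul_le_mul_of_nonneg_left (one_div_nine_pow_le m) hB0))

theorem IsPeanoX.tendsto_nodeSum_straight (hx : IsPeanoX x) (hg : Continuous g)
    (ht : t ∈ Set.Icc (0 : ℝ) 1) :
    Tendsto (nodeSum straight g t) atTop (nhds (1 / 4 * ∫ s in (0 : ℝ)..t, g (x s))) := by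
  obtain ⟨B, hB0, hB⟩ := exists_bound hg
  have hsub : Set.Icc (0 : ℝ) 1 ⊆ Set.Icc (-1) 2 := Set.Icc_subset_Icc (by norm_num) (by norm_num)
  rw [show 1 / 4 * ∫ s in (0 : ℝ)..t, g (x s) = 9 / 8 * (2 / 9 * ∫ s in (0 : ℝ)..t, g (x s)) by ring]
  apply tendsto_of_tendsto_sub_div_nine
  have herr : Tendsto (fun m => nodeSum straight g t (m + 1) - nodeSum straight g t m / 9 -
      2 / 9 * nodeSum (fun _ => 1) g t m) atTop (nhds 0) := by
    refine tendsto_of_eventually_le_add_div (B := B) fun η hη => ?_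
    filter_upwards [eventually_modulus hg hη] with m hm
    set K := ⌊((9 ^ m : ℕ) : ℝ) * t⌋₊ with hK
    set K' := ⌊((9 ^ (m + 1) : ℕ) : ℝ) * t⌋₊ with hK'
    have h9 : (0 : ℝ) < 9 ^ m := by positivity
    have hKT : K ≤ 9 ^ m := floor_mul_le ht
    have hKT' : K' ≤ 9 ^ (m + 1) := floor_mul_le ht
    have ht0 := ht.1
    have hle : 9 * K ≤ K' := by
      refine Nat.le_floor ?_
      have := Nat.floor_le (a := ((9 ^ m : ℕ) : ℝ) * t) (by positivity)
      rw [← hK] at this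
      push_cast at this ⊢
      rw [pow_succ]
      linarith
    have hlt : K' < 9 * K + 9 := by
      refine (Nat.floor_lt (by positivity)).2 ?_
      have := Nat.lt_floor_add_one (((9 ^ m : ℕ) : ℝ) * t)
      rw [← hK] at this
      push_cast at this ⊢
      rw [pow_succ]
      linarith
    have hblock : ∀ N, ∑ k ∈ range (9 * N), straight k * g (height k / 3 ^ (m + 1)) =
        ∑ k ∈ range N, ∑ i ∈ range 9,
          straight (9 * k + i) * g (height (9 * k + i) / 3 ^ (m + 1)) := by
      intro N
      induction N with
      | zero => simp
      | succ N ih => rw [mul_add, mul_one, sum_range_add, ih, sum_range_succ _ N]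
    have hcoarse : ∀ k ∈ range K,
        |∑ i ∈ range 9, straight (9 * k + i) * g (height (9 * k + i) / 3 ^ (m + 1)) -
          (2 + straight k) * g (height k / 3 ^ m)| ≤ 9 * η := by
      intro k hk
      have hk' := mem_range.1 hk
      rw [← sum_straight_nine_mul, sum_mul, ← sum_sub_distrib]
      refine (abs_sum_le_sum_abs _ _).trans ?_
      refine (sum_le_card_nsmul _ _ η fun i hi => ?_).trans (by simp)
      have hi' := mem_range.1 hi
      rw [← mul_sub, abs_mul, abs_of_nonneg (straight_nonneg _)]
      refine (mul_le_of_le_one_left (abs_nonneg _) (straight_le_one _)).trans ?_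
      refine hm _ (hsub (hx.height_mem _ _ (by omega))) _
        (hsub (hx.height_mem _ _ (by omega))) ?_
      have h3 : |(height (9 * k + i) : ℝ) - 3 * height k| ≤ 3 := by
        exact_mod_cast abs_height_nine_mul_add_sub_le k i hi'
      have e : (height (9 * k + i) : ℝ) / 3 ^ (m + 1) - height k / 3 ^ m =
          ((height (9 * k + i) : ℝ) - 3 * height k) / 3 ^ (m + 1) := by
        rw [pow_succ]; field_simp
      rw [e, abs_div, abs_of_pos (show (0 : ℝ) < 3 ^ (m + 1) by positivity), pow_succ,
        div_le_div_iff₀ (by positivity) (by positivity)]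
      nlinarith [show (0 : ℝ) < 3 ^ m by positivity]
    have htail : |∑ k ∈ Ico (9 * K) K', straight k * g (height k / 3 ^ (m + 1))| ≤ 9 * B := by
      refine (abs_sum_le_sum_abs _ _).trans ?_
      refine (sum_le_card_nsmul _ _ B fun k hk => ?_).trans ?_
      · have hk' := mem_Ico.1 hk
        rw [abs_mul, abs_of_nonneg (straight_nonneg _)]
        exact (mul_le_of_le_one_left (abs_nonneg _) (straight_le_one _)).trans
          (hB _ (hsub (hx.height_mem _ _ (by omega))))
      · rw [Nat.card_Ico, nsmul_eq_mul]
        have : ((K' - 9 * K : ℕ) : ℝ) ≤ 9 := by exact_mod_cast (by omega)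
        gcongr
    have e : nodeSum straight g t (m + 1) - nodeSum straight g t m / 9 -
        2 / 9 * nodeSum (fun _ => 1) g t m - 0 =
        (∑ k ∈ range K, (∑ i ∈ range 9,
          straight (9 * k + i) * g (height (9 * k + i) / 3 ^ (m + 1)) -
          (2 + straight k) * g (height k / 3 ^ m)) +
          ∑ k ∈ Ico (9 * K) K', straight k * g (height k / 3 ^ (m + 1))) / 9 ^ (m + 1) := by
      simp only [nodeSum, ← hK, ← hK']
      rw [sum_sub_distrib, ← hblock, sub_add_eq_add_sub, sum_range_add_sum_Ico _ hle]
      simp only [add_mul, sum_add_distrib, one_mul, ← mul_sum]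
      rw [pow_succ]
      field_simp
      ring
    rw [e, abs_div, abs_of_pos (show (0 : ℝ) < 9 ^ (m + 1) by positivity),
      div_le_iff₀ (by positivity)]
    refine (abs_add_le _ _).trans ?_
    have h1 : |∑ k ∈ range K, (∑ i ∈ range 9,
          straight (9 * k + i) * g (height (9 * k + i) / 3 ^ (m + 1)) -
          (2 + straight k) * g (height k / 3 ^ m))| ≤ 9 ^ m * (9 * η) := by
      refine (abs_sum_le_sum_abs _ _).trans ((sum_le_sum hcoarse).trans ?_)
      rw [sum_const, card_range, nsmul_eq_mul]
      have : (K : ℝ) ≤ 9 ^ m := by exact_mod_cast hKT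
      gcongr
    have h2 : 1 ≤ (1 / 3 : ℝ) ^ m * 9 ^ m := by
      have := one_div_nine_pow_le m
      rwa [div_le_iff₀ h9] at this
    have h3 : B * 1 ≤ B * ((1 / 3 : ℝ) ^ m * 9 ^ m) := by gcongr
    rw [pow_succ (9 : ℝ) m]
    linarith
  have := herr.add ((hx.tendsto_nodeSum_one hg ht).const_mul (2 / 9))
  simpa using this

end Limit

section Integral

open Finset MeasureTheory

variable {g : ℝ → ℝ} {t : ℝ}

theorem indicator_one_mul_apply (s : Set ℝ) (g : ℝ → ℝ) (z : ℝ) :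
    s.indicator (1 : ℝ → ℝ) z * g z = s.indicator g z := by
  by_cases h : z ∈ s <;> simp [h]

theorem integrableOn_indicator_mul (hg : Continuous g) (a b u v : ℝ) :
    IntegrableOn (fun z => (Set.Ioo a b).indicator (1 : ℝ → ℝ) z * g z) (Set.Icc u v) := by
  simp only [indicator_one_mul_apply]
  exact hg.integrableOn_Icc.indicator measurableSet_Ioo

theorem abs_setIntegral_indicator_mul_sub_le (hg : Continuous g) {D : Set ℝ}
    {a b v η : ℝ} (hab : a ≤ b) (hD : Set.Ioo a b ⊆ D)
    (h : ∀ z ∈ Set.Ioo a b, |g z - v| ≤ η) :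
    |(∫ z in D, (Set.Ioo a b).indicator (1 : ℝ → ℝ) z * g z) - (b - a) * v| ≤ (b - a) * η := by
  have hvol : volume.real (Set.Ioo a b) = b - a := by
    rw [Measure.real, Real.volume_Ioo, ENNReal.toReal_ofReal (by linarith)]
  have hint : IntegrableOn g (Set.Ioo a b) := hg.integrableOn_Icc.mono_set Set.Ioo_subset_Icc_self
  have e : (∫ z in D, (Set.Ioo a b).indicator (1 : ℝ → ℝ) z * g z) - (b - a) * v =
      ∫ z in Set.Ioo a b, (g z - v) := by
    simp only [indicator_one_mul_apply]
    rw [setIntegral_indicator measurableSet_Ioo, Set.inter_eq_self_of_subset_right hD,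
      integral_sub hint (integrableOn_const (by simp)), setIntegral_const, hvol, smul_eq_mul]
  rw [e, mul_comm, ← hvol]
  exact norm_setIntegral_le_of_norm_le_const (f := fun z => g z - v) measure_Ioo_lt_top h

theorem integrableOn_pathCrossCount_mul (hg : Continuous g) (δ c : ℝ) (y : ℕ → ℤ) (K : ℕ)
    (u v : ℝ) : IntegrableOn (fun z => pathCrossCount δ c y K z * g z) (Set.Icc u v) := by
  simp only [pathCrossCount, sum_mul, add_mul, mul_assoc]
  exact integrable_finsetSum _ fun k _ => (integrableOn_indicator_mul hg _ _ u v).add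
    ((integrableOn_indicator_mul hg _ _ u v).const_mul _)

theorem IsPeanoX.abs_integral_pathCrossCount_sub_le (hx : IsPeanoX x) (hg : Continuous g)
    (ht : t ∈ Set.Icc (0 : ℝ) 1) {P η : ℝ} (hP0 : 0 < P) (hP1 : P ≤ 1) (hη : 0 ≤ η) {m : ℕ}
    (hm : ∀ a ∈ Set.Icc (-1 : ℝ) 2, ∀ b ∈ Set.Icc (-1 : ℝ) 2, |a - b| ≤ 2 / 3 ^ m →
      |g a - g b| ≤ η) :
    |P / 3 ^ m * (∫ z in Set.Icc (-1 : ℝ) 2,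
        pathCrossCount (1 / 3 ^ m) (P / 3 ^ m) height ⌊((9 ^ m : ℕ) : ℝ) * t⌋₊ z * g z) -
      (P * (1 - P) * nodeSum (fun _ => 1) g t m + P ^ 2 * nodeSum straight g t m)| ≤ η := by
  set K := ⌊((9 ^ m : ℕ) : ℝ) * t⌋₊ with hK
  have hKT : K ≤ 9 ^ m := floor_mul_le ht
  set δ : ℝ := 1 / 3 ^ m with hδ
  set c : ℝ := P / 3 ^ m with hc
  have hδ0 : 0 < δ := by positivity
  have hc0 : 0 < c := by positivity
  have hδ1 : δ ≤ 1 := by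
    rw [hδ, div_le_one (by positivity)]
    exact one_le_pow₀ (by norm_num)
  have hcδ : c ≤ δ := by rw [hc, hδ]; gcongr
  have hnode : ∀ k ≤ K, δ * height k ∈ Set.Icc (0 : ℝ) 1 := fun k hk => by
    rw [hδ, one_div_mul_eq_div]
    exact hx.height_mem m k (hk.trans hKT)
  have hη' : ∀ z w : ℝ, -1 ≤ z → z ≤ 2 → w ∈ Set.Icc (0 : ℝ) 1 → |z - w| ≤ 2 * δ →
      |g z - g w| ≤ η := fun z w h1 h2 h3 h4 =>
    hm z ⟨h1, h2⟩ w ⟨by linarith [h3.1], by linarith [h3.2]⟩ (by rwa [hδ, mul_one_div] at h4)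
  have hedge : ∀ k < K,
      |(∫ z in Set.Icc (-1 : ℝ) 2,
          (Set.Ioo (δ * (min (height k) (height (k + 1)) : ℤ) + c / 2)
            (δ * ((min (height k) (height (k + 1)) : ℤ) + 1) - c / 2)).indicator
              (1 : ℝ → ℝ) z * g z) -
        (δ - c) * g (δ * height k)| ≤ (δ - c) * η := by
    intro k hk
    have h0 := hnode k hk.le
    have h1 := hnode (k + 1) hk
    set e := min (height k) (height (k + 1)) with he
    have h2 : 0 ≤ δ * e ∧ δ * (e + 1) ≤ 1 ∧ (height k = e ∨ height k = e + 1) := by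
      rcases stepSign_eq_or k with h | h
      · rw [show e = height k by rw [he, height_succ, h]; omega]
        rw [height_succ, h] at h1
        push_cast at h1
        exact ⟨h0.1, h1.2, Or.inl rfl⟩
      · rw [show e = height k - 1 by rw [he, height_succ, h]; omega]
        rw [height_succ, h] at h1
        push_cast at h1 ⊢
        exact ⟨h1.1, by linarith [h0.2], Or.inr (by ring)⟩
    have h3 : δ * e ≤ δ * height k ∧ δ * height k ≤ δ * e + δ := by
      rcases h2.2.2 with h | h <;> rw [h] <;> push_cast <;> constructor <;> linarith
    have := abs_setIntegral_indicator_mul_sub_le hg (D := Set.Icc (-1) 2)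
      (a := δ * e + c / 2) (b := δ * (e + 1) - c / 2) (v := g (δ * height k)) (η := η)
      (by linarith) (fun z hz => ⟨by linarith [hz.1], by linarith [hz.2]⟩)
      (fun z hz => hη' z _ (by linarith [hz.1]) (by linarith [hz.2]) h0
        (abs_le.2 ⟨by linarith [hz.1], by linarith [hz.2]⟩))
    rwa [show δ * ((e : ℝ) + 1) - c / 2 - (δ * e + c / 2) = δ - c by ring] at this
  have hvertex : ∀ k < K,
      |(∫ z in Set.Icc (-1 : ℝ) 2,
          (Set.Ioo (δ * height (k + 1) - c / 2) (δ * height (k + 1) + c / 2)).indicator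
              (1 : ℝ → ℝ) z * g z) - c * g (δ * height k)| ≤ c * η := by
    intro k hk
    have h0 := hnode k hk.le
    have h1 := hnode (k + 1) hk
    have h3 : |δ * height (k + 1) - δ * height k| ≤ δ := by
      rw [height_succ]
      rcases stepSign_eq_or k with h | h <;> rw [h] <;> push_cast <;> rw [abs_le] <;>
        constructor <;> linarith
    rw [abs_le] at h3
    have := abs_setIntegral_indicator_mul_sub_le hg (D := Set.Icc (-1) 2)
      (a := δ * height (k + 1) - c / 2) (b := δ * height (k + 1) + c / 2)
      (v := g (δ * height k)) (η := η)
      (by linarith) (fun z hz => ⟨by linarith [hz.1, h1.1], by linarith [hz.2, h1.2]⟩)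
      (fun z hz => hη' z _ (by linarith [hz.1, h1.1]) (by linarith [hz.2, h1.2]) h0
        (abs_le.2 ⟨by linarith [hz.1], by linarith [hz.2]⟩))
    rwa [show δ * (height (k + 1) : ℝ) + c / 2 - (δ * height (k + 1) - c / 2) = c by ring] at this
  have hstep : ∀ k ∈ range K,
      |(∫ z in Set.Icc (-1 : ℝ) 2,
          (Set.Ioo (δ * (min (height k) (height (k + 1)) : ℤ) + c / 2)
            (δ * ((min (height k) (height (k + 1)) : ℤ) + 1) - c / 2)).indicator
              (1 : ℝ → ℝ) z * g z) +
        straight k * (∫ z in Set.Icc (-1 : ℝ) 2,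
          (Set.Ioo (δ * height (k + 1) - c / 2) (δ * height (k + 1) + c / 2)).indicator
              (1 : ℝ → ℝ) z * g z) -
        ((δ - c) + straight k * c) * g (δ * height k)| ≤ δ * η := by
    intro k hk
    have h1 := hedge k (mem_range.1 hk)
    have h2 := mul_le_mul_of_nonneg_left (hvertex k (mem_range.1 hk)) (straight_nonneg k)
    rw [← abs_of_nonneg (straight_nonneg k), ← abs_mul, abs_of_nonneg (straight_nonneg k)] at h2
    have h3 : straight k * (c * η) ≤ c * η :=
      mul_le_of_le_one_left (by positivity) (straight_le_one k)
    rw [show ∀ a s b d : ℝ, a + s * b - (δ - c + s * c) * d = (a - (δ - c) * d) + s * (b - c * d)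
      from fun a s b d => by ring]
    refine (abs_add_le _ _).trans ?_
    linarith
  have hsum : (∫ z in Set.Icc (-1 : ℝ) 2, pathCrossCount δ c height K z * g z) =
      ∑ k ∈ range K, ((∫ z in Set.Icc (-1 : ℝ) 2,
          (Set.Ioo (δ * (min (height k) (height (k + 1)) : ℤ) + c / 2)
            (δ * ((min (height k) (height (k + 1)) : ℤ) + 1) - c / 2)).indicator
              (1 : ℝ → ℝ) z * g z) +
        straight k * (∫ z in Set.Icc (-1 : ℝ) 2,
          (Set.Ioo (δ * height (k + 1) - c / 2) (δ * height (k + 1) + c / 2)).indicator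
              (1 : ℝ → ℝ) z * g z)) := by
    simp only [pathCrossCount, sum_mul, add_mul, mul_assoc]
    rw [integral_finsetSum _ fun k _ => Integrable.fun_add (integrableOn_indicator_mul hg _ _ _ _)
      ((integrableOn_indicator_mul hg _ _ _ _).const_mul _)]
    refine sum_congr rfl fun k _ => ?_
    rw [integral_add (integrableOn_indicator_mul hg _ _ _ _)
      ((integrableOn_indicator_mul hg _ _ _ _).const_mul _), integral_const_mul]
    rfl
  have h9 : (9 : ℝ) ^ m = 3 ^ m * 3 ^ m := by rw [← mul_pow]; norm_num
  have hmain : P * (1 - P) * nodeSum (fun _ => 1) g t m + P ^ 2 * nodeSum straight g t m =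
      c * ∑ k ∈ range K, ((δ - c) + straight k * c) * g (δ * height k) := by
    simp only [nodeSum, ← hK, add_mul, sum_add_distrib, mul_right_comm _ c, ← sum_mul, ← mul_sum,
      one_mul, hδ, one_div_mul_eq_div]
    rw [h9, hc]
    field_simp
  rw [hmain, hsum, ← mul_sub, ← sum_sub_distrib, abs_mul, abs_of_pos hc0]
  calc c * |_| ≤ c * (K * (δ * η)) := by
        gcongr
        refine (abs_sum_le_sum_abs _ _).trans ((sum_le_sum hstep).trans ?_)
        rw [sum_const, card_range, nsmul_eq_mul]
    _ ≤ c * (9 ^ m * (δ * η)) := by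
        have : (K : ℝ) ≤ 9 ^ m := by exact_mod_cast hKT
        gcongr
    _ = P * η := by rw [h9, hc, hδ]; field_simp
    _ ≤ η := mul_le_of_le_one_left hη hP1

theorem IsPeanoX.abs_integral_crossCount_sub_le (hx : IsPeanoX x) (hg : Continuous g)
    (ht : t ∈ Set.Icc (0 : ℝ) 1) {P B : ℝ} (hP : 1 / 3 < P) (hP1 : P ≤ 1)
    (hB : ∀ a ∈ Set.Icc (-1 : ℝ) 2, |g a| ≤ B) (m : ℕ) :
    |(∫ z, (crossCount x z (P / 3 ^ m) t : ℝ) * g z) - ∫ z in Set.Icc (-1 : ℝ) 2,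
        pathCrossCount (1 / 3 ^ m) (P / 3 ^ m) height ⌊((9 ^ m : ℕ) : ℝ) * t⌋₊ z * g z| ≤
      6 * B := by
  have hP0 : 0 < P := by linarith
  set K := ⌊((9 ^ m : ℕ) : ℝ) * t⌋₊ with hK
  set δ : ℝ := 1 / 3 ^ m with hδ
  set c : ℝ := P / 3 ^ m with hc
  have hT : 0 < 9 ^ m := by positivity
  have hδ0 : 0 < δ := by positivity
  have hc0 : 0 < c := by positivity
  have hcδ : c ≤ δ := by rw [hc, hδ]; gcongr
  have h : FollowsPath x (9 ^ m) δ c height := hx.followsPath m (by rw [hc]; gcongr)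
  have hf : ContinuousOn x (Set.Icc 0 t) :=
    hx.continuousOn.mono (Set.Icc_subset_Icc_right ht.2)
  have hmeas := h.measurable_crossCount hT hδ0 hf ht hc0
  have hres : (∫ z, (crossCount x z c t : ℝ) * g z) =
      ∫ z in Set.Icc (-1 : ℝ) 2, (crossCount x z c t : ℝ) * g z := by
    refine (setIntegral_eq_integral_of_forall_compl_eq_zero fun z hz => ?_).symm
    rw [h.crossCount_eq_zero hT hδ0 hf ht hc0 (fun u hu => hx.mem_Icc hu)
      (fun hz' => hz ⟨by linarith [hz'.1], by linarith [hz'.2]⟩)]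
    simp
  have hnull : ∀ᵐ z : ℝ, (∀ j : ℤ, z - c / 2 ≠ δ * j) ∧ ∀ j : ℤ, z + c / 2 ≠ δ * j := by
    have h1 : (Set.range fun j : ℤ => δ * j + c / 2).Countable := Set.countable_range _
    have h2 : (Set.range fun j : ℤ => δ * j - c / 2).Countable := Set.countable_range _
    filter_upwards [h1.ae_notMem volume, h2.ae_notMem volume] with z hz1 hz2
    exact ⟨fun j hj => hz1 ⟨j, by simp only; linarith⟩, fun j hj => hz2 ⟨j, by simp only; linarith⟩⟩
  have hbound : ∀ᵐ z ∂(volume.restrict (Set.Icc (-1 : ℝ) 2)),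
      ‖(crossCount x z c t : ℝ) * g z - pathCrossCount δ c height K z * g z‖ ≤ 2 * B := by
    filter_upwards [ae_restrict_of_ae hnull, ae_restrict_mem measurableSet_Icc] with z hz hz'
    rw [Real.norm_eq_abs, ← sub_mul, abs_mul]
    exact mul_le_mul (h.abs_crossCount_sub_le hT hδ0 hf ht hc0 hcδ hz.1 hz.2) (hB z hz')
      (abs_nonneg _) (by norm_num)
  have hpath := integrableOn_pathCrossCount_mul hg δ c height K (-1) 2
  have hdiff : IntegrableOn (fun z => (crossCount x z c t : ℝ) * g z -
      pathCrossCount δ c height K z * g z) (Set.Icc (-1) 2) := by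
    refine Integrable.of_bound (AEStronglyMeasurable.sub ?_ hpath.1) (2 * B) hbound
    exact ((measurable_from_top.comp hmeas).mul hg.measurable).aestronglyMeasurable
  have hcross : IntegrableOn (fun z => (crossCount x z c t : ℝ) * g z) (Set.Icc (-1) 2) := by
    simpa only [IntegrableOn, sub_add_cancel] using Integrable.fun_add hdiff hpath
  rw [hres, ← integral_sub hcross hpath]
  have := norm_integral_le_of_norm_le_const hbound
  simp only [measureReal_restrict_apply_univ, Real.volume_real_Icc] at this
  norm_num at this
  linarith

theorem IsPeanoX.tendsto_integral_crossCount (hx : IsPeanoX x) (hg : Continuous g)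
    (ht : t ∈ Set.Icc (0 : ℝ) 1) {P : ℝ} (hP : 1 / 3 < P) (hP1 : P ≤ 1) :
    Tendsto (fun m : ℕ => P / 3 ^ m * ∫ z, (crossCount x z (P / 3 ^ m) t : ℝ) * g z) atTop
      (nhds (P * (1 - 3 / 4 * P) * ∫ s in (0 : ℝ)..t, g (x s))) := by
  obtain ⟨B, hB0, hB⟩ := exists_bound hg
  have hP0 : 0 < P := by linarith
  have herr : Tendsto (fun m : ℕ =>
      P / 3 ^ m * (∫ z, (crossCount x z (P / 3 ^ m) t : ℝ) * g z) -
        (P * (1 - P) * nodeSum (fun _ => 1) g t m + P ^ 2 * nodeSum straight g t m))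
      atTop (nhds 0) := by
    refine tendsto_of_eventually_le_add_div (B := 6 * B) fun η hη => ?_
    filter_upwards [eventually_modulus hg hη] with m hm
    have h1 := hx.abs_integral_pathCrossCount_sub_le hg ht hP0 hP1 hη.le hm
    have h2 := hx.abs_integral_crossCount_sub_le hg ht hP hP1 hB m
    have h3 := mul_le_mul_of_nonneg_left h2 (show 0 ≤ P / 3 ^ m by positivity)
    rw [← abs_of_pos (show 0 < P / 3 ^ m by positivity), ← abs_mul,
      abs_of_pos (show 0 < P / 3 ^ m by positivity), mul_sub] at h3
    have h4 : P / 3 ^ m * (6 * B) ≤ 6 * B * (1 / 3) ^ m := by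
      rw [mul_comm, one_div_pow]
      gcongr
    rw [sub_zero]
    refine (abs_sub_le _ (P / 3 ^ m * ∫ z in Set.Icc (-1 : ℝ) 2,
      pathCrossCount (1 / 3 ^ m) (P / 3 ^ m) height ⌊((9 ^ m : ℕ) : ℝ) * t⌋₊ z * g z) _).trans ?_
    linarith
  have hlim := herr.add (((hx.tendsto_nodeSum_one hg ht).const_mul (P * (1 - P))).add
    ((hx.tendsto_nodeSum_straight hg ht).const_mul (P ^ 2)))
  simp only [sub_add_cancel] at hlim
  convert hlim using 2
  ring

theorem zpow_floor_neg_logb_mul_mem {p : ℝ} (hp : 0 < p) :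
    (3 : ℝ) ^ ⌊-Real.logb 3 p⌋ * p ∈ Set.Ioc (1 / 3 : ℝ) 1 := by
  have hp3 : p = (3 : ℝ) ^ Real.logb 3 p := (Real.rpow_logb (by norm_num) (by norm_num) hp).symm
  have h : (3 : ℝ) ^ ⌊-Real.logb 3 p⌋ * p =
      (3 : ℝ) ^ ((⌊-Real.logb 3 p⌋ : ℝ) + Real.logb 3 p) := by
    rw [Real.rpow_add (by norm_num), ← hp3, Real.rpow_intCast]
  have h1 := Int.floor_le (-Real.logb 3 p)
  have h2 := Int.lt_floor_add_one (-Real.logb 3 p)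
  rw [h]
  constructor
  · rw [one_div, ← Real.rpow_neg_one]
    exact Real.rpow_lt_rpow_of_exponent_lt (by norm_num) (by linarith)
  · exact Real.rpow_le_one_of_one_le_of_nonpos (by norm_num) (by linarith)

end Integral

end PeanoCurve

/-- Convergence of the normalized numbers of interval crossings of the horizontal component of
the Peano curve tested against a continuous function:
`3^{-n} p ∫ n_t^{z,3^{-n}p}(x) g(z) dz → C_p ∫_0^t g(x(s)) ds`. -/
theorem peano_crossings_limit (x : ℝ → ℝ) (hx : IsPeanoX x)
    (p' q' : ℕ) (hp'pos : 0 < p') (hq'pos : 0 < q')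
    (hp'3 : ¬ (3 ∣ p')) (hq'3 : ¬ (3 ∣ q'))
    (p : ℝ) (hp : p = (p' : ℝ) / (q' : ℝ))
    (g : ℝ → ℝ) (hg : Continuous g)
    (t : ℝ) (ht : t ∈ Set.Icc (0 : ℝ) 1) :
    Filter.Tendsto
      (fun n : ℕ => p / 3 ^ n * ∫ z : ℝ, (crossCount x z (p / 3 ^ n) t : ℝ) * g z)
      Filter.atTop
      (nhds ((3 : ℝ) ^ (⌊-Real.logb 3 p⌋) * p *
          (1 - 3 / 4 * ((3 : ℝ) ^ (⌊-Real.logb 3 p⌋) * p)) *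
        ∫ s in (0 : ℝ)..t, g (x s))) := by
  have hp0 : 0 < p := by rw [hp]; positivity
  set N := ⌊-Real.logb 3 p⌋ with hN
  obtain ⟨hP, hP1⟩ := zpow_floor_neg_logb_mul_mem hp0
  rw [← hN] at hP hP1
  have hshift : Tendsto (fun n : ℕ => ((n : ℤ) + N).toNat) atTop atTop :=
    tendsto_atTop.2 fun b => by
      filter_upwards [eventually_ge_atTop (b + N.natAbs)] with n hn
      omega
  refine ((hx.tendsto_integral_crossCount hg ht hP hP1).comp hshift).congr' ?_
  filter_upwards [eventually_ge_atTop N.natAbs] with n hn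
  have h : (3 : ℝ) ^ N * p / 3 ^ ((n : ℤ) + N).toNat = p / 3 ^ n := by
    rw [← zpow_natCast (3 : ℝ) ((n : ℤ) + N).toNat, Int.toNat_of_nonneg (by omega),
      zpow_add₀ (by norm_num), zpow_natCast]
    field_simp
  simp only [Function.comp_apply, h]
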